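/- Fix n ≥ 3 and let E = EuclideanSpace ℝ (Fin n). Let R > 0 and let u : E → ℝ be infinitely differentiable on the exterior region Ω = {x : ‖x‖ > R} (ContDiffOn ℝ ⊤ u Ω) and solve the minimal surface equation there: for every x ∈ Ω, ∑ i ⟪fderiv ℝ (fun y => (Real.sqrt (1 + ‖gradient u y‖^2))⁻¹ • gradient u y) x (e i), e i⟫ = 0, where (e i) is the standard orthonormal basis. Assume moreover that the gradient decays at infinity: for every ε > 0 there is R' such that ‖gradient u x‖ ≤ ε whenever ‖x‖ ≥ R'. Then there exist a ∈ ℝ and C > 0 such that |u x − a| ≤ C * ‖x‖^((2:ℝ) − n) for all x with ‖x‖ ≥ R + 1. -/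

import Mathlib

open scoped InnerProductSpace

namespace MSE

open Filter Topology

abbrev Eu (n : ℕ) := EuclideanSpace ℝ (Fin n)

/-- second-order data of `f` at `x` along lines -/
def LJ {n : ℕ} (f : Eu n → ℝ) (x p : Eu n) (H : Eu n → ℝ) : Prop :=
  ∀ ξ : Eu n, ∃ φ : ℝ → ℝ, (∀ᶠ t in 𝓝 (0:ℝ), HasDerivAt (fun s : ℝ => f (x + s • ξ)) (φ t) t) ∧
    φ 0 = ⟪p, ξ⟫_ℝ ∧ HasDerivAt φ (H ξ) 0

/-- standard basis -/
noncomputable abbrev bb (n : ℕ) : OrthonormalBasis (Fin n) ℝ (Eu n) := EuclideanSpace.basisFun (Fin n) ℝ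

/-- second-order data solving the minimal surface equation at a point -/
def MJ {n : ℕ} (f : Eu n → ℝ) (x p : Eu n) : Prop :=
  ∃ H : Eu n →L[ℝ] Eu n →L[ℝ] ℝ, LJ f x p (fun ξ => H ξ ξ) ∧
    ∑ i, H (bb n i) (bb n i) = (1 + ‖p‖ ^ 2)⁻¹ * H p p

theorem second_test {F φ : ℝ → ℝ} {c : ℝ} (h1 : ∀ᶠ t in 𝓝 (0:ℝ), HasDerivAt F (φ t) t)
    (h2 : HasDerivAt φ c 0) (hm : IsLocalMax F 0) : φ 0 = 0 ∧ c ≤ 0 := by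
  have h0 : φ 0 = 0 := hm.hasDerivAt_eq_zero h1.self_of_nhds
  refine ⟨h0, ?_⟩
  by_contra hc
  push Not at hc
  have hd : deriv F =ᶠ[𝓝 0] φ := h1.mono fun t ht => ht.deriv
  have hdd : deriv (deriv F) 0 = c := by rw [hd.deriv_eq]; exact h2.deriv
  have hmin : IsLocalMin F 0 := by
    apply isLocalMin_of_deriv_deriv_pos (by rw [hdd]; exact hc)
    · rw [hd.self_of_nhds, h0]
    · exact h1.self_of_nhds.continuousAt
  have hconst : F =ᶠ[𝓝 0] fun _ => F 0 := by
    filter_upwards [hm, hmin] with t a b using le_antisymm a b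
  have : deriv F =ᶠ[𝓝 0] fun _ => 0 := by
    have := hconst.deriv
    simpa using this
  have h3 := this.deriv_eq
  rw [hdd] at h3
  simp at h3
  linarith

theorem LJ.neg {n : ℕ} {f : Eu n → ℝ} {x p : Eu n} {H : Eu n → ℝ} (h : LJ f x p H) :
    LJ (fun y => - f y) x (-p) (fun ξ => - H ξ) := by
  intro ξ
  obtain ⟨φ, h1, h2, h3⟩ := h ξ
  refine ⟨fun t => - φ t, h1.mono fun t ht => ht.neg, by simp [h2], h3.neg⟩

theorem MJ.neg {n : ℕ} {f : Eu n → ℝ} {x p : Eu n} (h : MJ f x p) :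
    MJ (fun y => - f y) x (-p) := by
  obtain ⟨H, h1, h2⟩ := h
  refine ⟨-H, by simpa using h1.neg, ?_⟩
  simp [-EuclideanSpace.basisFun_apply, h2]

/-- reflection -/
noncomputable def rf {n : ℕ} (e : Eu n) : Eu n →L[ℝ] Eu n :=
  ContinuousLinearMap.id ℝ _ - (2:ℝ) • (innerSL ℝ e).smulRight e

theorem rf_apply {n : ℕ} (e x : Eu n) : rf e x = x - (2 * ⟪e, x⟫_ℝ) • e := by
  simp [rf, smul_smul]

theorem rf_inner {n : ℕ} (e x y : Eu n) (he : ‖e‖ = 1) : ⟪rf e x, rf e y⟫_ℝ = ⟪x, y⟫_ℝ := by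
  simp only [rf_apply, inner_sub_left, inner_sub_right, real_inner_smul_left, real_inner_smul_right,
    real_inner_self_eq_norm_sq, he, real_inner_comm e]
  rw [real_inner_comm y x]
  ring

theorem rf_norm {n : ℕ} (e x : Eu n) (he : ‖e‖ = 1) : ‖rf e x‖ = ‖x‖ := by
  have := rf_inner e x x he
  rw [real_inner_self_eq_norm_sq, real_inner_self_eq_norm_sq] at this
  exact (sq_eq_sq₀ (norm_nonneg _) (norm_nonneg _)).1 this

theorem rf_rf {n : ℕ} (e x : Eu n) (he : ‖e‖ = 1) : rf e (rf e x) = x := by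
  simp only [rf_apply, inner_sub_right, real_inner_smul_right,
    real_inner_self_eq_norm_sq, he]
  module

theorem sum_bil {n : ℕ} (v : Eu n) : ∑ i, ⟪v, bb n i⟫_ℝ • bb n i = v := by
  have := (bb n).sum_repr v
  simpa [OrthonormalBasis.repr_apply_apply, real_inner_comm] using this

theorem sum_H1 {n : ℕ} (H : Eu n →L[ℝ] Eu n →L[ℝ] ℝ) (v w : Eu n) :
    ∑ i, ⟪v, bb n i⟫_ℝ * H (bb n i) w = H v w := by
  conv_rhs => rw [← sum_bil v]
  simp [-EuclideanSpace.basisFun_apply, -EuclideanSpace.inner_basisFun_real]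

theorem sum_H2 {n : ℕ} (H : Eu n →L[ℝ] Eu n →L[ℝ] ℝ) (v w : Eu n) :
    ∑ i, ⟪v, bb n i⟫_ℝ * H w (bb n i) = H w v := by
  conv_rhs => rw [← sum_bil v]
  simp [-EuclideanSpace.basisFun_apply, -EuclideanSpace.inner_basisFun_real]

theorem sum_sq {n : ℕ} (v w : Eu n) : ∑ i, ⟪v, bb n i⟫_ℝ * ⟪w, bb n i⟫_ℝ = ⟪v, w⟫_ℝ := by
  have := (bb n).sum_inner_mul_inner v w
  rw [← this]
  refine Finset.sum_congr rfl fun i _ => ?_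
  rw [real_inner_comm w]

/-- trace of `H` on rank-one perturbation of the identity -/
theorem sum_rank_one {n : ℕ} (H : Eu n →L[ℝ] Eu n →L[ℝ] ℝ) (p : Eu n) (s : ℝ) :
    ∑ i, H (bb n i - (s * ⟪p, bb n i⟫_ℝ) • p) (bb n i - (s * ⟪p, bb n i⟫_ℝ) • p)
      = ∑ i, H (bb n i) (bb n i) - (2 * s - s ^ 2 * ‖p‖ ^ 2) * H p p := by
  have h1 := sum_H1 H p p
  have h2 := sum_H2 H p p
  have h3 := sum_sq p p
  rw [real_inner_self_eq_norm_sq] at h3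
  have : ∀ i, H (bb n i - (s * ⟪p, bb n i⟫_ℝ) • p) (bb n i - (s * ⟪p, bb n i⟫_ℝ) • p)
      = H (bb n i) (bb n i) - s * (⟪p, bb n i⟫_ℝ * H (bb n i) p) - s * (⟪p, bb n i⟫_ℝ * H p (bb n i))
        + s ^ 2 * H p p * (⟪p, bb n i⟫_ℝ * ⟪p, bb n i⟫_ℝ) := by
    intro i
    simp only [map_sub, map_smul, sub_apply, smul_apply,
      smul_eq_mul]
    ring
  simp only [this, Finset.sum_add_distrib, Finset.sum_sub_distrib, ← Finset.mul_sum, h1, h2, h3]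
  ring

/-- the coefficient `1/(W(W+1))` -/
noncomputable def ss {n : ℕ} (p : Eu n) : ℝ :=
  (Real.sqrt (1 + ‖p‖ ^ 2) * (Real.sqrt (1 + ‖p‖ ^ 2) + 1))⁻¹

/-- square root of the coefficient matrix -/
noncomputable def Bm {n : ℕ} (p ξ : Eu n) : Eu n := ξ - (ss p * ⟪p, ξ⟫_ℝ) • p

theorem W_facts {n : ℕ} (p : Eu n) : 1 ≤ Real.sqrt (1 + ‖p‖ ^ 2) ∧
    Real.sqrt (1 + ‖p‖ ^ 2) ^ 2 = 1 + ‖p‖ ^ 2 := by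
  constructor
  · rw [Real.one_le_sqrt]; nlinarith [sq_nonneg ‖p‖]
  · exact Real.sq_sqrt (by positivity)

theorem ss_key {n : ℕ} (p : Eu n) : 2 * ss p - ss p ^ 2 * ‖p‖ ^ 2 = (1 + ‖p‖ ^ 2)⁻¹ := by
  obtain ⟨h1, h2⟩ := W_facts p
  unfold ss
  set W := Real.sqrt (1 + ‖p‖ ^ 2)
  have h3 : ‖p‖ ^ 2 = W ^ 2 - 1 := by linarith
  rw [h3]
  have : W ≠ 0 := by positivity
  have : W + 1 ≠ 0 := by positivity
  have : 1 + (W ^ 2 - 1) ≠ 0 := by ring_nf; positivity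
  field_simp
  ring

theorem ss_pos {n : ℕ} (p : Eu n) : 0 < ss p := by
  obtain ⟨h1, h2⟩ := W_facts p
  unfold ss; positivity

theorem ss_le {n : ℕ} (p : Eu n) : ss p ≤ 1 / 2 := by
  obtain ⟨h1, h2⟩ := W_facts p
  unfold ss
  rw [one_div]
  apply inv_anti₀ (by norm_num)
  nlinarith

theorem ss_mul_le {n : ℕ} (p : Eu n) : ss p * ‖p‖ ^ 2 ≤ 1 := by
  obtain ⟨h1, h2⟩ := W_facts p
  unfold ss
  set W := Real.sqrt (1 + ‖p‖ ^ 2)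
  have h3 : ‖p‖ ^ 2 = W ^ 2 - 1 := by linarith
  rw [h3, inv_mul_le_one₀ (by positivity)]
  nlinarith

theorem ss_lip {n : ℕ} (p q : Eu n) : |ss p - ss q| ≤ (‖p‖ + ‖q‖) * ‖p - q‖ := by
  obtain ⟨h1, h2⟩ := W_facts p
  obtain ⟨h1', h2'⟩ := W_facts q
  unfold ss
  set W := Real.sqrt (1 + ‖p‖ ^ 2)
  set V := Real.sqrt (1 + ‖q‖ ^ 2)
  have hW : 0 < W * (W + 1) := by positivity
  have hV : 0 < V * (V + 1) := by positivity
  have key : |V ^ 2 - W ^ 2| ≤ (‖p‖ + ‖q‖) * ‖p - q‖ := by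
    have : V ^ 2 - W ^ 2 = (‖p‖ + ‖q‖) * (‖q‖ - ‖p‖) := by rw [h2, h2']; ring
    rw [this, abs_mul, abs_of_nonneg (by positivity)]
    gcongr
    rw [abs_sub_comm]; exact abs_norm_sub_norm_le p q
  have e : (W * (W + 1))⁻¹ - (V * (V + 1))⁻¹ = (V - W) * (V + W + 1) / ((W * (W + 1)) * (V * (V + 1))) := by
    field_simp; ring
  have e2 : |V - W| * (V + W) = |V ^ 2 - W ^ 2| := by
    rw [show V ^ 2 - W ^ 2 = (V - W) * (V + W) by ring, abs_mul, abs_of_pos (by linarith : 0 < V + W)]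
  rw [e, abs_div, abs_mul, abs_of_pos (by linarith : 0 < V + W + 1), abs_of_pos (by positivity : 0 < (W * (W + 1)) * (V * (V + 1)))]
  rw [div_le_iff₀ (by positivity)]
  have h4 : 4 ≤ (W * (W + 1)) * (V * (V + 1)) := by
    have a1 : 2 ≤ W * (W + 1) := by nlinarith
    have a2 : 2 ≤ V * (V + 1) := by nlinarith
    nlinarith
  have h5 : |V - W| * (V + W + 1) ≤ 2 * |V ^ 2 - W ^ 2| := by
    rw [← e2]; nlinarith [abs_nonneg (V - W)]
  have h6 : 0 ≤ (‖p‖ + ‖q‖) * ‖p - q‖ := by positivity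
  nlinarith

theorem Bm_sum {n : ℕ} (H : Eu n →L[ℝ] Eu n →L[ℝ] ℝ) (p : Eu n) 
    (h : ∑ i, H (bb n i) (bb n i) = (1 + ‖p‖ ^ 2)⁻¹ * H p p) :
    ∑ i, H (Bm p (bb n i)) (Bm p (bb n i)) = 0 := by
  unfold Bm
  rw [sum_rank_one, h, ss_key]; ring

theorem MJ.refl {n : ℕ} {f : Eu n → ℝ} {y p e : Eu n} (he : ‖e‖ = 1) (h : MJ f (rf e y) p) :
    MJ (fun y => f (rf e y)) y (rf e p) := by
  obtain ⟨H, h1, h2⟩ := h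
  refine ⟨(((ContinuousLinearMap.compL ℝ (Eu n) (Eu n) ℝ).flip (rf e)).comp (H.comp (rf e))), ?_, ?_⟩
  · intro ξ
    obtain ⟨φ, a1, a2, a3⟩ := h1 (rf e ξ)
    refine ⟨φ, ?_, ?_, ?_⟩
    · simpa using a1
    · rw [a2, ← rf_inner e _ _ he, rf_rf e _ he]
    · simpa using a3
  · rw [rf_norm e p he]
    simp only [ContinuousLinearMap.comp_apply, ContinuousLinearMap.flip_apply,
      ContinuousLinearMap.compL_apply, rf_rf e p he]
    rw [← h2]
    simp only [rf_apply]
    rw [sum_rank_one, he]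
    ring

theorem LJ.of_contDiff {n : ℕ} {f : Eu n → ℝ} {x : Eu n} (h : ContDiffAt ℝ 2 f x) :
    LJ f x (gradient f x) (fun ξ => fderiv ℝ (fderiv ℝ f) x ξ ξ) := by
  intro ξ
  have hl : ∀ t : ℝ, HasDerivAt (fun s : ℝ => x + s • ξ) ξ t := fun t => by
    simpa using ((hasDerivAt_id t).smul_const ξ).const_add x
  have hc : Tendsto (fun s : ℝ => x + s • ξ) (𝓝 0) (𝓝 x) := by
    have := (hl 0).continuousAt.tendsto
    simpa using this
  refine ⟨fun t => fderiv ℝ f (x + t • ξ) ξ, ?_, ?_, ?_⟩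
  · have : ∀ᶠ y in 𝓝 x, ContDiffAt ℝ 2 f y := h.eventually (by simp)
    filter_upwards [hc.eventually this] with t ht
    exact (ht.differentiableAt (by norm_num)).hasFDerivAt.comp_hasDerivAt t (hl t)
  · simp [gradient]
  · have h2 : DifferentiableAt ℝ (fderiv ℝ f) x := 
      (h.fderiv_right (m := 1) (by norm_num)).differentiableAt (by norm_num)
    have h3 : HasDerivAt (fun t : ℝ => fderiv ℝ f (x + t • ξ)) (fderiv ℝ (fderiv ℝ f) x ξ) 0 := by
      have : HasFDerivAt (fderiv ℝ f) (fderiv ℝ (fderiv ℝ f) x) (x + (0:ℝ) • ξ) := by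
        simpa using h2.hasFDerivAt
      exact this.comp_hasDerivAt 0 (hl 0)
    simpa using h3.clm_apply (hasDerivAt_const (0:ℝ) ξ)

/-- translation of the divergence-form equation -/
theorem MJ.of_div {n : ℕ} {u : Eu n → ℝ} {x : Eu n} (h : ContDiffAt ℝ 2 u x)
    (hm : ∑ i : Fin n,
        ⟪fderiv ℝ (fun y : EuclideanSpace ℝ (Fin n) =>
            (Real.sqrt (1 + ‖gradient u y‖ ^ 2))⁻¹ • gradient u y) x
          (EuclideanSpace.single i (1 : ℝ)),
          EuclideanSpace.single i (1 : ℝ)⟫_ℝ = 0) : MJ u x (gradient u x) := by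
  refine ⟨_, LJ.of_contDiff h, ?_⟩
  have h2 : DifferentiableAt ℝ (fderiv ℝ u) x := 
      (h.fderiv_right (m := 1) (by norm_num)).differentiableAt (by norm_num)
  set D := fderiv ℝ (fderiv ℝ u) x
  set p := gradient u x
  let J : StrongDual ℝ (Eu n) →L[ℝ] Eu n := 
    LinearMap.toContinuousLinearMap
      { toFun := fun l => (InnerProductSpace.toDual ℝ (Eu n)).symm l
        map_add' := by simp
        map_smul' := by simp }
  have hJ : ∀ (l : StrongDual ℝ (Eu n)) v, ⟪J l, v⟫_ℝ = l v := by
    intro l v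
    simp [J]
  have hg : HasFDerivAt (gradient u) (J.comp D) x := by
    exact J.hasFDerivAt.comp x h2.hasFDerivAt
  have hw : HasFDerivAt (fun y => 1 + ‖gradient u y‖ ^ 2) (2 • (innerSL ℝ p).comp (J.comp D)) x := 
    hg.norm_sq.const_add 1
  obtain ⟨hW1, hW2⟩ := W_facts p
  have hpos : (1 + ‖gradient u x‖ ^ 2) ≠ 0 := by positivity
  have hX := ((hasDerivAt_inv (by positivity : Real.sqrt (1 + ‖gradient u x‖ ^ 2) ≠ 0)).comp_hasFDerivAt x
    (hw.sqrt hpos)).smul hg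
  change HasFDerivAt (fun y => (Real.sqrt (1 + ‖gradient u y‖ ^ 2))⁻¹ • gradient u y) _ x at hX
  rw [hX.fderiv] at hm
  change ∑ i, _ = _ at hm
  set W := Real.sqrt (1 + ‖p‖ ^ 2) with hWdef
  have hsum : ∑ i, (W⁻¹ * D (bb n i) (bb n i) - (W ^ 3)⁻¹ * (⟪p, bb n i⟫_ℝ * D (bb n i) p)) = 0 := by
    rw [← hm]
    refine Finset.sum_congr rfl fun i _ => ?_
    rw [← EuclideanSpace.basisFun_apply]
    simp [-EuclideanSpace.basisFun_apply, -EuclideanSpace.inner_basisFun_real, hJ, inner_add_left,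
      real_inner_smul_left]
    have hp : fderiv ℝ u x (bb n i) = ⟪p, bb n i⟫_ℝ := by
      simp only [p, gradient, InnerProductSpace.toDual_symm_apply]
    have hq : ⟪p, J (D (bb n i))⟫_ℝ = D (bb n i) p := by rw [real_inner_comm, hJ]
    rw [hp, hq]
    change _ = W⁻¹ * _ + _
    field_simp
    ring
  rw [Finset.sum_sub_distrib, ← Finset.mul_sum, ← Finset.mul_sum, sum_H1] at hsum
  rw [← hW2]
  have hW0 : W ≠ 0 := by positivity
  field_simp at hsum ⊢
  linarith

end MSE

namespace MSE

open Filter Topology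

/-- barrier functions -/
noncomputable def bar {n : ℕ} (a c A μ : ℝ) (e z : Eu n) : ℝ :=
  c + (‖z‖ ^ 2) ^ (-a) * (A + μ * ⟪e, z⟫_ℝ)

theorem bar_LJ {n : ℕ} (a c A μ : ℝ) (e z : Eu n) (hz : z ≠ 0) :
    LJ (bar a c A μ e) z
      ((-(2 * a) * (‖z‖ ^ 2) ^ (-a - 1) * (A + μ * ⟪e, z⟫_ℝ)) • z + (μ * (‖z‖ ^ 2) ^ (-a)) • e)
      (fun ζ => (A + μ * ⟪e, z⟫_ℝ) * (-(2 * a) * (‖z‖ ^ 2) ^ (-a - 1) * ‖ζ‖ ^ 2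
          + 4 * a * (a + 1) * (‖z‖ ^ 2) ^ (-a - 2) * ⟪z, ζ⟫_ℝ ^ 2)
        - 4 * a * μ * (‖z‖ ^ 2) ^ (-a - 1) * (⟪z, ζ⟫_ℝ * ⟪e, ζ⟫_ℝ)) := by
  intro ξ
  have hl : ∀ t : ℝ, HasDerivAt (fun s : ℝ => z + s • ξ) ξ t := fun t => by
    simpa using ((hasDerivAt_id t).smul_const ξ).const_add z
  have hs : ∀ t : ℝ, HasDerivAt (fun s : ℝ => ‖z + s • ξ‖ ^ 2) (2 * ⟪z + t • ξ, ξ⟫_ℝ) t :=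
    fun t => (hl t).norm_sq
  have hi : ∀ (v : Eu n) (t : ℝ), HasDerivAt (fun s : ℝ => ⟪v, z + s • ξ⟫_ℝ) ⟪v, ξ⟫_ℝ t := fun v t => by
    simpa using (hasDerivAt_const t v).inner ℝ (hl t)
  have hi' : HasDerivAt (fun s : ℝ => ⟪z + s • ξ, ξ⟫_ℝ) (‖ξ‖ ^ 2) 0 := by
    have := (hl 0).inner ℝ (hasDerivAt_const (0:ℝ) ξ)
    simpa using this
  have hA : ∀ t : ℝ, HasDerivAt (fun s : ℝ => A + μ * ⟪e, z + s • ξ⟫_ℝ) (μ * ⟪e, ξ⟫_ℝ) t :=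
    fun t => ((hi e t).const_mul μ).const_add A
  have hp : ∀ (b t : ℝ), z + t • ξ ≠ 0 → HasDerivAt (fun s : ℝ => (‖z + s • ξ‖ ^ 2) ^ b)
      (2 * ⟪z + t • ξ, ξ⟫_ℝ * b * (‖z + t • ξ‖ ^ 2) ^ (b - 1)) t := fun b t ht =>
    (hs t).rpow_const (Or.inl (by positivity))
  have hne : ∀ᶠ t in 𝓝 (0:ℝ), z + t • ξ ≠ 0 := by
    have : ContinuousAt (fun s : ℝ => z + s • ξ) 0 := (hl 0).continuousAt
    apply this.eventually_ne
    simpa using hz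
  refine ⟨fun t => 2 * ⟪z + t • ξ, ξ⟫_ℝ * (-a) * (‖z + t • ξ‖ ^ 2) ^ (-a - 1) * (A + μ * ⟪e, z + t • ξ⟫_ℝ)
    + (‖z + t • ξ‖ ^ 2) ^ (-a) * (μ * ⟪e, ξ⟫_ℝ), ?_, ?_, ?_⟩
  · filter_upwards [hne] with t ht
    exact ((hp (-a) t ht).mul (hA t)).const_add c
  · simp [inner_add_left, real_inner_smul_left]
    ring
  · have h0 : z + (0:ℝ) • ξ ≠ 0 := by simpa using hz
    have := ((((hi'.const_mul 2).mul_const (-a)).mul (hp (-a - 1) 0 h0)).mul (hA 0)).add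
      ((hp (-a) 0 h0).mul_const (μ * ⟪e, ξ⟫_ℝ))
    refine this.congr_deriv ?_
    simp only [zero_smul, add_zero, Pi.mul_apply]
    rw [show -a - 1 - 1 = -a - 2 by ring]
    ring

/-- Two-point maximum principle. -/
theorem two_point {n : ℕ} {f g ψ : Eu n → ℝ} {z k h p q gψ : Eu n} {Hψ : Eu n → ℝ} {δ : ℝ}
    (hf : MJ f (z + (1/2:ℝ) • k) p) (hg : MJ g (z - (1/2:ℝ) • k) q) (hψ : LJ ψ z gψ Hψ)
    (hm : IsLocalMax (fun w : Eu n × Eu n => f (w.1 + (1/2:ℝ) • w.2) - g (w.1 - (1/2:ℝ) • w.2)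
      - ψ w.1 - ‖w.2 - h‖ ^ 2 / (2 * δ)) (z, k)) :
    p - q = gψ ∧ 0 ≤ ∑ i, Hψ ((1/2:ℝ) • (Bm p (bb n i) + Bm q (bb n i)))
      + δ⁻¹ * ∑ i, ‖Bm p (bb n i) - Bm q (bb n i)‖ ^ 2 := by
  obtain ⟨Hf, hf1, hf2⟩ := hf
  obtain ⟨Hg, hg1, hg2⟩ := hg
  have key : ∀ ξ η : Eu n, (⟪p, ξ⟫_ℝ - ⟪q, η⟫_ℝ - ⟪gψ, (1/2:ℝ) • (ξ + η)⟫_ℝ - 2 * ⟪k - h, ξ - η⟫_ℝ / (2 * δ) = 0)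
      ∧ Hf ξ ξ - Hg η η - Hψ ((1/2:ℝ) • (ξ + η)) - (2 * ‖ξ - η‖ ^ 2) / (2 * δ) ≤ 0 := by
    intro ξ η
    obtain ⟨φ1, a1, a2, a3⟩ := hf1 ξ
    obtain ⟨φ2, b1, b2, b3⟩ := hg1 η
    obtain ⟨φ3, c1, c2, c3⟩ := hψ ((1/2:ℝ) • (ξ + η))
    have hl : ∀ t : ℝ, HasDerivAt (fun s : ℝ => (k - h) + s • (ξ - η)) (ξ - η) t := fun t => by
      simpa using ((hasDerivAt_id t).smul_const (ξ - η)).const_add (k - h)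
    have d1 : ∀ t : ℝ, HasDerivAt (fun s : ℝ => ‖(k - h) + s • (ξ - η)‖ ^ 2)
        (2 * ⟪(k - h) + t • (ξ - η), ξ - η⟫_ℝ) t := fun t => (hl t).norm_sq
    have d3 : HasDerivAt (fun s : ℝ => 2 * ⟪(k - h) + s • (ξ - η), ξ - η⟫_ℝ) (2 * ‖ξ - η‖ ^ 2) 0 := by
      have := ((hl 0).inner ℝ (hasDerivAt_const (0:ℝ) (ξ - η))).const_mul 2
      simpa using this
    have tot := second_test (F := fun s : ℝ => f (z + (1/2:ℝ) • k + s • ξ) - g (z - (1/2:ℝ) • k + s • η)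
        - ψ (z + s • ((1/2:ℝ) • (ξ + η))) - ‖(k - h) + s • (ξ - η)‖ ^ 2 / (2 * δ))
      (φ := fun s => φ1 s - φ2 s - φ3 s - 2 * ⟪(k - h) + s • (ξ - η), ξ - η⟫_ℝ / (2 * δ))
      (by
        filter_upwards [a1, b1, c1] with t h1 h2 h3
        exact ((h1.sub h2).sub h3).sub ((d1 t).div_const _))
      (((a3.sub b3).sub c3).sub (d3.div_const _))
      (by
        have hc : Tendsto (fun s : ℝ => (z + s • ((1/2:ℝ) • (ξ + η)), k + s • (ξ - η))) (𝓝 0) (𝓝 (z, k)) := by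
          have : Continuous (fun s : ℝ => (z + s • ((1/2:ℝ) • (ξ + η)), k + s • (ξ - η))) := by fun_prop
          have := this.tendsto 0
          simpa using this
        have h2 := hc.eventually hm
        filter_upwards [h2] with s hs
        have e1 : z + s • ((1/2:ℝ) • (ξ + η)) + (1/2:ℝ) • (k + s • (ξ - η)) = z + (1/2:ℝ) • k + s • ξ := by
          module
        have e2 : z + s • ((1/2:ℝ) • (ξ + η)) - (1/2:ℝ) • (k + s • (ξ - η)) = z - (1/2:ℝ) • k + s • η := by
          module
        have e3 : k + s • (ξ - η) - h = k - h + s • (ξ - η) := by module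
        simp only [e1, e2, e3] at hs
        simpa using hs)
    refine ⟨?_, tot.2⟩
    have := tot.1
    simpa [a2, b2, c2] using this
  constructor
  · rw [← sub_eq_zero]
    have h1 := (key (p - q - gψ) (p - q - gψ)).1
    rw [← inner_self_eq_zero (𝕜 := ℝ)]
    have h2 : (1/2:ℝ) • (p - q - gψ + (p - q - gψ)) = p - q - gψ := by module
    rw [h2, sub_self, inner_zero_right, mul_zero, zero_div] at h1
    conv_lhs => rw [inner_sub_left, inner_sub_left]
    linarith
  · have h1 : ∀ i, Hf (Bm p (bb n i)) (Bm p (bb n i)) - Hg (Bm q (bb n i)) (Bm q (bb n i)) ≤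
       Hψ ((1/2:ℝ) • (Bm p (bb n i) + Bm q (bb n i))) + δ⁻¹ * ‖Bm p (bb n i) - Bm q (bb n i)‖ ^ 2 := by
      intro i
      have := (key (Bm p (bb n i)) (Bm q (bb n i))).2
      rw [mul_div_mul_left _ _ (two_ne_zero), div_eq_inv_mul (‖_‖ ^ 2) δ] at this
      linarith
    have h2 := Finset.sum_le_sum fun i (_ : i ∈ Finset.univ) => h1 i
    rw [Finset.sum_sub_distrib, Finset.sum_add_distrib, Bm_sum Hf p hf2, Bm_sum Hg q hg2,
      ← Finset.mul_sum] at h2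
    linarith

/-- One-point maximum principle. -/
theorem one_point {n : ℕ} {f ψ : Eu n → ℝ} {z p gψ : Eu n} {Hψ : Eu n → ℝ}
    (hf : MJ f z p) (hψ : LJ ψ z gψ Hψ)
    (hm : IsLocalMax (fun w : Eu n => f w - ψ w) z) :
    p = gψ ∧ 0 ≤ ∑ i, Hψ (Bm p (bb n i)) := by
  obtain ⟨Hf, hf1, hf2⟩ := hf
  have key : ∀ ξ : Eu n, (⟪p, ξ⟫_ℝ - ⟪gψ, ξ⟫_ℝ = 0) ∧ Hf ξ ξ - Hψ ξ ≤ 0 := by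
    intro ξ
    obtain ⟨φ1, a1, a2, a3⟩ := hf1 ξ
    obtain ⟨φ3, c1, c2, c3⟩ := hψ ξ
    have tot := second_test (F := fun s : ℝ => f (z + s • ξ) - ψ (z + s • ξ))
      (φ := fun s => φ1 s - φ3 s)
      (by
        filter_upwards [a1, c1] with t h1 h3
        exact h1.sub h3)
      (a3.sub c3)
      (by
        have hc : Tendsto (fun s : ℝ => z + s • ξ) (𝓝 0) (𝓝 z) := by
          have : Continuous (fun s : ℝ => z + s • ξ) := by fun_prop
          have := this.tendsto 0
          simpa using this
        have h2 := hc.eventually hm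
        filter_upwards [h2] with s hs
        simpa using hs)
    refine ⟨?_, tot.2⟩
    have := tot.1
    simpa [a2, c2] using this
  constructor
  · rw [← sub_eq_zero]
    have h1 := (key (p - gψ)).1
    rw [← inner_self_eq_zero (𝕜 := ℝ)]
    conv_lhs => rw [inner_sub_left]
    linarith
  · have h2 := Finset.sum_le_sum fun i (_ : i ∈ Finset.univ) => sub_nonpos.1 (key (Bm p (bb n i))).2
    rw [Bm_sum Hf p hf2] at h2
    exact h2

theorem Bm_symm {n : ℕ} (p w ξ : Eu n) : ⟪w, Bm p ξ⟫_ℝ = ⟪Bm p w, ξ⟫_ℝ := by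
  simp only [Bm, inner_sub_left, inner_sub_right, real_inner_smul_left, real_inner_smul_right]
  rw [real_inner_comm p w]; ring

theorem Bm_norm {n : ℕ} (p w : Eu n) : ‖Bm p w‖ ≤ ‖w‖ := by
  have h : ‖Bm p w‖ ^ 2 ≤ ‖w‖ ^ 2 := by
    rw [← real_inner_self_eq_norm_sq, ← real_inner_self_eq_norm_sq]
    simp only [Bm, inner_sub_left, inner_sub_right, real_inner_smul_left, real_inner_smul_right]
    rw [real_inner_comm p w, real_inner_self_eq_norm_sq p]
    have h1 := ss_mul_le p
    have h2 := ss_pos p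
    have : 0 ≤ (ss p * ⟪p, w⟫_ℝ ^ 2) * (2 - ss p * ‖p‖ ^ 2) := by
      apply mul_nonneg (by positivity); linarith
    nlinarith
  exact le_of_sq_le_sq h (norm_nonneg _) 

theorem Bm_near {n : ℕ} (p w : Eu n) : ‖w - Bm p w‖ ≤ ‖p‖ ^ 2 / 2 * ‖w‖ := by
  have : w - Bm p w = (ss p * ⟪p, w⟫_ℝ) • p := by simp [Bm]
  rw [this, norm_smul, Real.norm_eq_abs, abs_mul, abs_of_pos (ss_pos p)]
  have h1 := abs_real_inner_le_norm p w
  have h2 := ss_le p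
  have h3 := ss_pos p
  calc ss p * |⟪p, w⟫_ℝ| * ‖p‖ ≤ (1/2) * (‖p‖ * ‖w‖) * ‖p‖ := by gcongr
    _ = _ := by ring

/-- averaged matrix -/
noncomputable def Sm {n : ℕ} (p q ξ : Eu n) : Eu n := (1/2:ℝ) • (Bm p ξ + Bm q ξ)

theorem Sm_symm {n : ℕ} (p q w ξ : Eu n) : ⟪w, Sm p q ξ⟫_ℝ = ⟪Sm p q w, ξ⟫_ℝ := by
  simp only [Sm, real_inner_smul_left, real_inner_smul_right, inner_add_left, inner_add_right, Bm_symm]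

theorem Sm_norm {n : ℕ} (p q w : Eu n) : ‖Sm p q w‖ ≤ ‖w‖ := by
  rw [Sm, norm_smul]
  have := norm_add_le (Bm p w) (Bm q w)
  have := Bm_norm p w
  have := Bm_norm q w
  norm_num
  linarith

theorem Sm_near {n : ℕ} (p q w : Eu n) (ε : ℝ) (hp : ‖p‖ ≤ ε) (hq : ‖q‖ ≤ ε) :
    ‖w - Sm p q w‖ ≤ ε ^ 2 / 2 * ‖w‖ := by
  have e : w - Sm p q w = (1/2:ℝ) • ((w - Bm p w) + (w - Bm q w)) := by rw [Sm]; module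
  rw [e, norm_smul]
  have := norm_add_le (w - Bm p w) (w - Bm q w)
  have h1 := Bm_near p w
  have h2 := Bm_near q w
  have h3 : ‖p‖ ^ 2 / 2 * ‖w‖ ≤ ε ^ 2 / 2 * ‖w‖ := by gcongr
  have h4 : ‖q‖ ^ 2 / 2 * ‖w‖ ≤ ε ^ 2 / 2 * ‖w‖ := by gcongr
  norm_num
  linarith

theorem Sm_sum_inner {n : ℕ} (p q v w : Eu n) :
    ∑ i, ⟪v, Sm p q (bb n i)⟫_ℝ * ⟪w, Sm p q (bb n i)⟫_ℝ = ⟪Sm p q v, Sm p q w⟫_ℝ := by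
  simp only [Sm_symm, sum_sq]

theorem Sm_sum_sq_le {n : ℕ} (p q v : Eu n) : ∑ i, ⟪v, Sm p q (bb n i)⟫_ℝ ^ 2 ≤ ‖v‖ ^ 2 := by
  have := Sm_sum_inner p q v v
  simp only [← pow_two] at this
  rw [this, real_inner_self_eq_norm_sq]
  have := Sm_norm p q v
  gcongr

theorem Sm_sum_norm {n : ℕ} (p q : Eu n) (ε : ℝ) (hp : ‖p‖ ≤ ε) (hq : ‖q‖ ≤ ε) :
    n * (1 - ε ^ 2) ≤ ∑ i, ‖Sm p q (bb n i)‖ ^ 2 := by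
  have : ∀ i ∈ Finset.univ, (1 - ε ^ 2) ≤ ‖Sm p q (bb n i)‖ ^ 2 := by
    intro i _
    have h1 := Sm_near p q (bb n i) ε hp hq
    have h2 := norm_sub_norm_le (bb n i) (Sm p q (bb n i))
    have h3 : ‖bb n i‖ = 1 := (bb n).norm_eq_one i
    rw [h3] at h1 h2
    by_cases hε : ε ^ 2 ≤ 2
    · have : (1 - ε ^ 2 / 2) ^ 2 ≤ ‖Sm p q (bb n i)‖ ^ 2 := by
        gcongr <;> linarith
      nlinarith [sq_nonneg (ε^2)]
    · nlinarith [sq_nonneg ‖Sm p q (bb n i)‖]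
  have := Finset.card_nsmul_le_sum _ _ _ this
  simpa using this

theorem Sm_cross {n : ℕ} (p q v w : Eu n) (ε : ℝ) (hp : ‖p‖ ≤ ε) (hq : ‖q‖ ≤ ε) :
    ⟪v, w⟫_ℝ - 2 * ε ^ 2 * (‖v‖ * ‖w‖) ≤ ∑ i, ⟪v, Sm p q (bb n i)⟫_ℝ * ⟪w, Sm p q (bb n i)⟫_ℝ := by
  rw [Sm_sum_inner]
  have h1 := Sm_near p q v ε hp hq
  have h2 := Sm_near p q w ε hp hq
  have e : ⟪v, w⟫_ℝ - ⟪Sm p q v, Sm p q w⟫_ℝ = ⟪v - Sm p q v, w⟫_ℝ + ⟪Sm p q v, w - Sm p q w⟫_ℝ := by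
    simp only [inner_sub_left, inner_sub_right]; ring
  have h3 := real_inner_le_norm (v - Sm p q v) w
  have h4 := real_inner_le_norm (Sm p q v) (w - Sm p q w)
  have h5 := Sm_norm p q v
  have h6 : ‖v - Sm p q v‖ * ‖w‖ ≤ ε ^ 2 / 2 * ‖v‖ * ‖w‖ := by gcongr
  have h7 : ‖Sm p q v‖ * ‖w - Sm p q w‖ ≤ ‖v‖ * (ε ^ 2 / 2 * ‖w‖) := by gcongr
  have : 0 ≤ ε ^ 2 * (‖v‖ * ‖w‖) := by positivity
  nlinarith

theorem Bm_diff {n : ℕ} (p q : Eu n) (ε : ℝ) (hp : ‖p‖ ≤ ε) (hq : ‖q‖ ≤ ε) (hε : ε ≤ 1) :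
    ∑ i, ‖Bm p (bb n i) - Bm q (bb n i)‖ ^ 2 ≤ 9 * n * ε ^ 2 * ‖p - q‖ ^ 2 := by
  have hε0 : 0 ≤ ε := (norm_nonneg p).trans hp
  have : ∀ i ∈ Finset.univ, ‖Bm p (bb n i) - Bm q (bb n i)‖ ^ 2 ≤ 9 * ε ^ 2 * ‖p - q‖ ^ 2 := by
    intro i _
    set ξ := bb n i
    have h3 : ‖ξ‖ = 1 := (bb n).norm_eq_one i
    have e : Bm p ξ - Bm q ξ = ((ss q - ss p) * ⟪q, ξ⟫_ℝ) • q
        + ((ss p * ⟪q - p, ξ⟫_ℝ) • q + (ss p * ⟪p, ξ⟫_ℝ) • (q - p)) := by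
      simp only [Bm, inner_sub_left]; module
    have hn : ‖Bm p ξ - Bm q ξ‖ ≤ 3 * ε * ‖p - q‖ := by
      rw [e]
      have a1 : ‖((ss q - ss p) * ⟪q, ξ⟫_ℝ) • q‖ ≤ 2 * ε * ‖p - q‖ := by
        rw [norm_smul, Real.norm_eq_abs, abs_mul]
        have b1 := ss_lip q p
        rw [norm_sub_rev] at b1
        have b2 := abs_real_inner_le_norm q ξ
        rw [h3, mul_one] at b2
        calc |ss q - ss p| * |⟪q, ξ⟫_ℝ| * ‖q‖ ≤ ((ε + ε) * ‖p - q‖) * 1 * 1 := by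
              gcongr
              · exact b1.trans (by gcongr)
              · linarith
              · linarith
          _ = _ := by ring
      have a2 : ‖(ss p * ⟪q - p, ξ⟫_ℝ) • q‖ ≤ 1/2 * ε * ‖p - q‖ := by
        rw [norm_smul, Real.norm_eq_abs, abs_mul, abs_of_pos (ss_pos p)]
        have b2 := abs_real_inner_le_norm (q - p) ξ
        rw [h3, mul_one, norm_sub_rev] at b2
        have := ss_le p
        have := ss_pos p
        calc ss p * |⟪q - p, ξ⟫_ℝ| * ‖q‖ ≤ (1/2) * ‖p - q‖ * ε := by gcongr
          _ = _ := by ring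
      have a3 : ‖(ss p * ⟪p, ξ⟫_ℝ) • (q - p)‖ ≤ 1/2 * ε * ‖p - q‖ := by
        rw [norm_smul, Real.norm_eq_abs, abs_mul, abs_of_pos (ss_pos p), norm_sub_rev]
        have b2 := abs_real_inner_le_norm p ξ
        rw [h3, mul_one] at b2
        have := ss_le p
        have := ss_pos p
        gcongr
        exact b2.trans hp
      have := norm_add₃_le (a := ((ss q - ss p) * ⟪q, ξ⟫_ℝ) • q) (b := (ss p * ⟪q - p, ξ⟫_ℝ) • q)
        (c := (ss p * ⟪p, ξ⟫_ℝ) • (q - p))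
      rw [← add_assoc]
      linarith
    calc ‖Bm p ξ - Bm q ξ‖ ^ 2 ≤ (3 * ε * ‖p - q‖) ^ 2 := by gcongr
      _ = _ := by ring
  have := Finset.sum_le_card_nsmul _ _ _ this
  simp only [Finset.card_univ, Fintype.card_fin, nsmul_eq_mul] at this
  linarith

end MSE

namespace MSE

open Filter Topology

structure Sol {n : ℕ} (R : ℝ) (u : Eu n → ℝ) : Prop where
  diff : ∀ x, R < ‖x‖ → DifferentiableAt ℝ u x
  mj : ∀ x, R < ‖x‖ → MJ u x (gradient u x)

theorem gradient_neg' {n : ℕ} (u : Eu n → ℝ) (x : Eu n) :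
    gradient (fun y => - u y) x = - gradient u x := by
  simp [gradient, fderiv_fun_neg]

theorem Sol.neg {n : ℕ} {R : ℝ} {u : Eu n → ℝ} (h : Sol R u) : Sol R (fun y => - u y) :=
  ⟨fun x hx => (h.diff x hx).neg, fun x hx => by rw [gradient_neg']; exact (h.mj x hx).neg⟩

theorem norm_grad {n : ℕ} (u : Eu n → ℝ) (x : Eu n) : ‖gradient u x‖ = ‖fderiv ℝ u x‖ := by
  simp [gradient]

theorem Sol.mv {n : ℕ} {R ρ ε : ℝ} {u : Eu n → ℝ} (h : Sol R u) (hρ : R < ρ)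
    (hg : ∀ w, ρ ≤ ‖w‖ → ‖gradient u w‖ ≤ ε) (x y : Eu n)
    (hs : ∀ w ∈ segment ℝ x y, ρ ≤ ‖w‖) : |u y - u x| ≤ ε * ‖y - x‖ := by
  have := (convex_segment (𝕜 := ℝ) x y).norm_image_sub_le_of_norm_fderiv_le (f := u) (C := ε)
    (fun w hw => h.diff w (hρ.trans_le (hs w hw)))
    (fun w hw => by rw [← norm_grad]; exact hg w (hs w hw))
    (left_mem_segment ℝ x y) (right_mem_segment ℝ x y)
  simpa using this

theorem Sol.osc {n : ℕ} {R ρ ε : ℝ} {u : Eu n → ℝ} (h : Sol R u) (hρ : R + 1 < ρ)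
    (hg : ∀ w, ρ - 1 ≤ ‖w‖ → ‖gradient u w‖ ≤ ε) (w k : Eu n) (hw : ρ ≤ ‖w‖) (hk : ‖k‖ ≤ 1) :
    u (w + (1/2:ℝ) • k) - u (w - (1/2:ℝ) • k) ≤ ε * ‖k‖ := by
  have := h.mv (ρ := ρ - 1) (by linarith) hg (w - (1/2:ℝ) • k) (w + (1/2:ℝ) • k) (by
    intro v hv
    have hc : Convex ℝ (Metric.closedBall w (1/2)) := convex_closedBall _ _
    have h1 : w - (1/2:ℝ) • k ∈ Metric.closedBall w (1/2) := by
      simp [dist_eq_norm, norm_smul]; linarith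
    have h2 : w + (1/2:ℝ) • k ∈ Metric.closedBall w (1/2) := by
      simp [dist_eq_norm, norm_smul]; linarith
    have h3 := hc.segment_subset h1 h2 hv
    rw [mem_closedBall_iff_norm'] at h3
    have := norm_sub_norm_le w v
    linarith)
  have e : w + (1/2:ℝ) • k - (w - (1/2:ℝ) • k) = k := by module
  rw [e] at this
  exact (le_abs_self _).trans this

theorem bar_sum {n : ℕ} (a A μ ε : ℝ) (e z p q : Eu n) (hz : z ≠ 0) (ha : 0 < a) (hμ : 0 ≤ μ)
    (he : ‖e‖ ≤ 1) (hM : 0 ≤ A + μ * ⟪e, z⟫_ℝ) (hp : ‖p‖ ≤ ε) (hq : ‖q‖ ≤ ε) :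
    ∑ i, (fun ζ => (A + μ * ⟪e, z⟫_ℝ) * (-(2 * a) * (‖z‖ ^ 2) ^ (-a - 1) * ‖ζ‖ ^ 2
          + 4 * a * (a + 1) * (‖z‖ ^ 2) ^ (-a - 2) * ⟪z, ζ⟫_ℝ ^ 2)
        - 4 * a * μ * (‖z‖ ^ 2) ^ (-a - 1) * (⟪z, ζ⟫_ℝ * ⟪e, ζ⟫_ℝ)) ((1/2:ℝ) • (Bm p (bb n i) + Bm q (bb n i)))
    ≤ (‖z‖ ^ 2) ^ (-a - 1) * ((A + μ * ⟪e, z⟫_ℝ) * (2 * a) * (- (n * (1 - ε ^ 2)) + 2 * (a + 1))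
       - 4 * a * μ * (⟪e, z⟫_ℝ - 2 * ε ^ 2 * ‖z‖)) := by
  change ∑ i, ((A + μ * ⟪e, z⟫_ℝ) * (-(2 * a) * (‖z‖ ^ 2) ^ (-a - 1) * ‖Sm p q (bb n i)‖ ^ 2
          + 4 * a * (a + 1) * (‖z‖ ^ 2) ^ (-a - 2) * ⟪z, Sm p q (bb n i)⟫_ℝ ^ 2)
        - 4 * a * μ * (‖z‖ ^ 2) ^ (-a - 1) * (⟪z, Sm p q (bb n i)⟫_ℝ * ⟪e, Sm p q (bb n i)⟫_ℝ)) ≤ _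
  have hs : 0 < ‖z‖ ^ 2 := by positivity
  have hX : (‖z‖ ^ 2) ^ (-a - 1) = (‖z‖ ^ 2) ^ (-a - 2) * ‖z‖ ^ 2 := by
    rw [← Real.rpow_add_one hs.ne']; congr 1; ring
  have hY : 0 < (‖z‖ ^ 2) ^ (-a - 2) := Real.rpow_pos_of_pos hs _
  rw [Finset.sum_sub_distrib, ← Finset.mul_sum, ← Finset.mul_sum, Finset.sum_add_distrib,
    ← Finset.mul_sum, ← Finset.mul_sum]
  have h1 := Sm_sum_norm p q ε hp hq
  have h2 := Sm_sum_sq_le p q z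
  have h3 := Sm_cross p q z e ε hp hq
  have h4 : 2 * ε ^ 2 * (‖z‖ * ‖e‖) ≤ 2 * ε ^ 2 * ‖z‖ := by
    have : ‖z‖ * ‖e‖ ≤ ‖z‖ * 1 := by gcongr
    rw [mul_one] at this
    gcongr
  rw [real_inner_comm e z] at h3
  set S1 := ∑ i, ‖Sm p q (bb n i)‖ ^ 2
  set S2 := ∑ i, ⟪z, Sm p q (bb n i)⟫_ℝ ^ 2
  set S3 := ∑ i, ⟪z, Sm p q (bb n i)⟫_ℝ * ⟪e, Sm p q (bb n i)⟫_ℝ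
  set X := (‖z‖ ^ 2) ^ (-a - 1)
  set Y := (‖z‖ ^ 2) ^ (-a - 2)
  set M := A + μ * ⟪e, z⟫_ℝ
  have hX0 : 0 < X := Real.rpow_pos_of_pos hs _
  have g1 : M * (2 * a) * X * (n * (1 - ε ^ 2)) ≤ M * (2 * a) * X * S1 := by gcongr
  have g2 : M * (4 * a * (a + 1)) * Y * S2 ≤ M * (4 * a * (a + 1)) * Y * ‖z‖ ^ 2 := by gcongr
  have g3 : 4 * a * μ * X * (⟪e, z⟫_ℝ - 2 * ε ^ 2 * ‖z‖) ≤ 4 * a * μ * X * S3 := by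
    gcongr; linarith
  have g4 : M * (4 * a * (a + 1)) * Y * ‖z‖ ^ 2 = M * (4 * a * (a + 1)) * X := by rw [hX]; ring
  nlinarith

theorem bar_continuousAt {n : ℕ} (a c A μ : ℝ) (e z : Eu n) (hz : z ≠ 0) :
    ContinuousAt (bar a c A μ e) z := by
  unfold bar
  have : ContinuousAt (fun z : Eu n => (‖z‖ ^ 2) ^ (-a)) z := by
    apply ContinuousAt.rpow_const (by fun_prop)
    left; positivity
  fun_prop

set_option maxHeartbeats 2000000 in
/-- First step, difference quotient estimate -/
theorem step1a {n : ℕ} (hn : 3 ≤ n) {R r0 ε : ℝ} (hR : 0 < R) {u : Eu n → ℝ} (h : Sol R u)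
    (hr0 : R + 1 < r0) (hε0 : 0 < ε) (hε : ε * (100 * n) ≤ 1)
    (hg : ∀ w, r0 - 1 ≤ ‖w‖ → ‖gradient u w‖ ≤ ε)
    (hdecay : ∀ ε : ℝ, 0 < ε → ∃ R' : ℝ, ∀ x : Eu n, ‖x‖ ≥ R' → ‖gradient u x‖ ≤ ε)
    (η : ℝ) (hη0 : 0 < η) (hη : η ≤ 1/2) (k0 : Eu n) (hk0 : ‖k0‖ = η) (τ : ℝ) (hτ : 0 < τ)
    (z0 : Eu n) (hz0 : r0 ≤ ‖z0‖) :
    u (z0 + (1/2:ℝ) • k0) - u (z0 - (1/2:ℝ) • k0) ≤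
      bar (3/8) (η * τ) (η * (2 * ε * (r0 ^ 2) ^ (3/8:ℝ))) 0 0 z0 := by
  by_contra hcon
  push Not at hcon
  have hnR : (3:ℝ) ≤ n := by exact_mod_cast hn
  have hεs : ε ≤ 1/300 := by nlinarith
  set A := 2 * ε * (r0 ^ 2) ^ (3/8:ℝ) with hA
  have hr00 : 0 < r0 := by linarith
  have hA0 : 0 < A := by positivity
  have hAT : ∀ z : Eu n, r0 ≤ ‖z‖ → A * (‖z‖ ^ 2) ^ (-(3/8):ℝ) ≤ 2 * ε := by
    intro z hz
    have h1 : (‖z‖ ^ 2) ^ (-(3/8):ℝ) ≤ (r0 ^ 2) ^ (-(3/8):ℝ) := by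
      apply Real.rpow_le_rpow_of_nonpos (by positivity) (by gcongr) (by norm_num)
    calc A * (‖z‖ ^ 2) ^ (-(3/8):ℝ) ≤ A * (r0 ^ 2) ^ (-(3/8):ℝ) := by gcongr
      _ = 2 * ε * ((r0 ^ 2) ^ (3/8:ℝ) * (r0 ^ 2) ^ (-(3/8):ℝ)) := by rw [hA]; ring
      _ = 2 * ε := by rw [← Real.rpow_add (by positivity)]; simp
  have hbar : ∀ z : Eu n, bar (3/8) (η * τ) (η * A) 0 0 z = η * τ + η * (A * (‖z‖ ^ 2) ^ (-(3/8):ℝ)) := by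
    intro z; simp [bar]; ring
  obtain ⟨R', hR'⟩ := hdecay (τ/2) (by positivity)
  set Lr := max (‖z0‖ + 1) (R' + 1) with hLr
  set F : Eu n × Eu n → ℝ := fun w => u (w.1 + (1/2:ℝ) • w.2) - u (w.1 - (1/2:ℝ) • w.2)
      - bar (3/8) (η * τ) (η * A) 0 0 w.1 - ‖w.2 - k0‖ ^ 2 / (2 * η) with hF
  set K : Set (Eu n × Eu n) := (Metric.closedBall 0 Lr ∩ {w | r0 ≤ ‖w‖}) ×ˢ Metric.closedBall k0 η with hK
  have hKc : IsCompact K := by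
    apply IsCompact.prod
    · exact (isCompact_closedBall 0 Lr).inter_right (isClosed_le continuous_const continuous_norm)
    · exact isCompact_closedBall _ _
  have hkn : ∀ k ∈ Metric.closedBall k0 η, ‖k‖ ≤ 2 * η := by
    intro k hk
    rw [mem_closedBall_iff_norm] at hk
    have := norm_le_norm_add_norm_sub' k k0
    linarith
  have hnorm1 : ∀ w k : Eu n, r0 ≤ ‖w‖ → ‖k‖ ≤ 1 → r0 - 1 ≤ ‖w + (1/2:ℝ) • k‖ ∧ r0 - 1 ≤ ‖w - (1/2:ℝ) • k‖ := by
    intro w k hw hk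
    have e : ‖(1/2:ℝ) • k‖ ≤ 1/2 := by rw [norm_smul]; norm_num; linarith
    have h1 := norm_sub_norm_le w (-((1/2:ℝ) • k))
    have h2 := norm_sub_norm_le w ((1/2:ℝ) • k)
    rw [norm_neg, sub_neg_eq_add] at h1
    constructor <;> linarith
  have hFc : ContinuousOn F K := by
    rintro ⟨w, k⟩ ⟨⟨hw1, hw2⟩, hk⟩
    apply ContinuousAt.continuousWithinAt
    have hk1 := hkn k hk
    obtain ⟨m1, m2⟩ := hnorm1 w k hw2 (by linarith)
    have c1 : ContinuousAt u (w + (1/2:ℝ) • k) := (h.diff _ (by linarith)).continuousAt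
    have c2 : ContinuousAt u (w - (1/2:ℝ) • k) := (h.diff _ (by linarith)).continuousAt
    have c3 : ContinuousAt (bar (3/8) (η * τ) (η * A) 0 (0 : Eu n)) w := by
      apply bar_continuousAt
      rintro rfl
      simp only [Set.mem_ofPred_eq, norm_zero] at hw2; linarith
    have d1 : ContinuousAt (fun w : Eu n × Eu n => u (w.1 + (1/2:ℝ) • w.2)) (w, k) :=
      ContinuousAt.comp (f := fun w : Eu n × Eu n => w.1 + (1/2:ℝ) • w.2) c1 (by fun_prop)
    have d2 : ContinuousAt (fun w : Eu n × Eu n => u (w.1 - (1/2:ℝ) • w.2)) (w, k) :=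
      ContinuousAt.comp (f := fun w : Eu n × Eu n => w.1 - (1/2:ℝ) • w.2) c2 (by fun_prop)
    have d3 : ContinuousAt (fun w : Eu n × Eu n => bar (3/8) (η * τ) (η * A) 0 (0 : Eu n) w.1) (w, k) :=
      ContinuousAt.comp (x := (w, k)) (f := fun w : Eu n × Eu n => w.1) (g := bar (3/8) (η * τ) (η * A) 0 (0 : Eu n)) c3 (by fun_prop)
    exact ((d1.sub d2).sub d3).sub (by fun_prop)
  have hmem0 : (z0, k0) ∈ K := by
    refine ⟨⟨?_, hz0⟩, by simp [hη0.le]⟩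
    simp only [mem_closedBall_iff_norm, sub_zero]
    exact (by linarith : ‖z0‖ ≤ ‖z0‖ + 1).trans (le_max_left _ _)
  obtain ⟨⟨z, k⟩, hzk, hmax⟩ := hKc.exists_isMaxOn ⟨_, hmem0⟩ hFc
  have hpos : 0 < F (z, k) := by
    have h1 : F (z0, k0) ≤ F (z, k) := hmax hmem0
    have h2 : 0 < F (z0, k0) := by
      simp only [hF, sub_self, norm_zero]
      simp
      linarith
    linarith
  obtain ⟨⟨hz1, hz2⟩, hk⟩ := hzk
  simp only [Set.mem_ofPred_eq] at hz2
  have hk2 := hkn k hk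
  have hk1 : ‖k‖ ≤ 1 := by linarith
  obtain ⟨m1, m2⟩ := hnorm1 z k hz2 hk1
  have hosc := h.osc hr0 hg z k hz2 hk1
  have hT := hAT z hz2
  have hz00 : z ≠ 0 := by rintro rfl; simp at hz2; linarith
  have hTpos : 0 < (‖z‖ ^ 2) ^ (-(3/8):ℝ) := Real.rpow_pos_of_pos (by positivity) _
  simp only [mem_closedBall_iff_norm, sub_zero] at hz1 hk
  have hFe : F (z, k) = u (z + (1/2:ℝ) • k) - u (z - (1/2:ℝ) • k)
      - (η * τ + η * (A * (‖z‖ ^ 2) ^ (-(3/8):ℝ))) - ‖k - k0‖ ^ 2 / (2 * η) := by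
    rw [← hbar]
  have hpen : 0 ≤ ‖k - k0‖ ^ 2 / (2 * η) := by positivity
  have hATp : 0 < η * (A * (‖z‖ ^ 2) ^ (-(3/8):ℝ)) := by positivity
  have hετ : 0 < η * τ := by positivity
  have i1 : ‖k - k0‖ < η := by
    refine lt_of_le_of_ne hk fun hke => ?_
    rw [hke] at hFe
    have : η ^ 2 / (2 * η) = η / 2 := by field_simp
    nlinarith
  have i2 : ‖z‖ < Lr := by
    refine lt_of_le_of_ne hz1 fun hze => ?_
    have hl1 : R' + 1 ≤ Lr := le_max_right _ _
    have hl2 : ‖z0‖ + 1 ≤ Lr := le_max_left _ _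
    have := h.osc (ρ := Lr) (ε := τ/2) (by linarith) (fun w hw => hR' w (by linarith)) z k hze.ge hk1
    nlinarith
  have i3 : r0 < ‖z‖ := by
    refine lt_of_le_of_ne hz2 fun hze => ?_
    have e1 : A * (‖z‖ ^ 2) ^ (-(3/8):ℝ) = 2 * ε := by
      rw [← hze]
      calc A * (r0 ^ 2) ^ (-(3/8):ℝ) = 2 * ε * ((r0 ^ 2) ^ (3/8:ℝ) * (r0 ^ 2) ^ (-(3/8):ℝ)) := by rw [hA]; ring
        _ = 2 * ε := by rw [← Real.rpow_add (by positivity)]; simp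
    nlinarith
  have hloc : IsLocalMax F (z, k) := by
    apply hmax.isLocalMax
    have hop : IsOpen ((Metric.ball 0 Lr ∩ {w : Eu n | r0 < ‖w‖}) ×ˢ Metric.ball k0 η) :=
      (Metric.isOpen_ball.inter (isOpen_lt continuous_const continuous_norm)).prod Metric.isOpen_ball
    apply mem_of_superset (hop.mem_nhds (x := (z, k)) ⟨⟨by simpa using i2, i3⟩, by simpa [dist_eq_norm] using i1⟩)
    apply Set.prod_mono
    · exact Set.inter_subset_inter Metric.ball_subset_closedBall (fun w (hw : r0 < ‖w‖) => (le_of_lt hw : r0 ≤ ‖w‖))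
    · exact Metric.ball_subset_closedBall
  have hp := hg _ m1
  have hq := hg _ m2
  obtain ⟨t1, t2⟩ := two_point (h.mj _ (by linarith)) (h.mj _ (by linarith))
    (bar_LJ (3/8) (η * τ) (η * A) 0 0 z hz00) hloc
  set p := gradient u (z + (1/2:ℝ) • k)
  set q := gradient u (z - (1/2:ℝ) • k)
  have s1 := bar_sum (3/8) (η * A) 0 ε 0 z p q hz00 (by norm_num) le_rfl (by simp) (by simp; positivity) hp hq
  have s2 := Bm_diff p q ε hp hq (by linarith)
  have s3 : ‖p - q‖ ^ 2 = (9/16) * (η * A) ^ 2 * ((‖z‖ ^ 2) ^ (-(3/8):ℝ) * (‖z‖ ^ 2) ^ (-(3/8) - 1:ℝ)) := by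
    have hs : 0 < ‖z‖ ^ 2 := by positivity
    rw [t1]
    simp only [zero_mul, add_zero, zero_smul]
    rw [norm_smul, mul_pow, Real.norm_eq_abs, sq_abs]
    have : (‖z‖ ^ 2) ^ (-(3/8):ℝ) = (‖z‖ ^ 2) ^ (-(3/8) - 1:ℝ) * ‖z‖ ^ 2 := by
      rw [← Real.rpow_add_one hs.ne']; congr 1; ring
    rw [this]
    ring
  have hX0 : 0 < (‖z‖ ^ 2) ^ (-(3/8) - 1:ℝ) := Real.rpow_pos_of_pos (by positivity) _
  simp only [inner_zero_left, mul_zero, add_zero, zero_mul, sub_zero] at s1 t2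
  have fin : 0 ≤ (‖z‖ ^ 2) ^ (-(3/8) - 1:ℝ) * (η * A * (2 * (3/8)) * (-(n * (1 - ε ^ 2)) + 2 * (3/8 + 1)))
     + η⁻¹ * (9 * n * ε ^ 2 * ((9/16) * (η * A) ^ 2 * ((‖z‖ ^ 2) ^ (-(3/8):ℝ) * (‖z‖ ^ 2) ^ (-(3/8) - 1:ℝ)))) := by
    refine t2.trans (add_le_add s1 ?_)
    rw [s3] at s2
    gcongr
  set X := (‖z‖ ^ 2) ^ (-(3/8) - 1:ℝ)
  set T := (‖z‖ ^ 2) ^ (-(3/8):ℝ)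
  have e2 : X * (η * A * (2 * (3/8)) * (-(n * (1 - ε ^ 2)) + 2 * (3/8 + 1)))
     + η⁻¹ * (9 * n * ε ^ 2 * ((9/16) * (η * A) ^ 2 * (T * X)))
     = (X * η * A) * ((3/4) * (-n + n * ε ^ 2 + 11/4) + (81/16) * (n * ε ^ 2) * (A * T)) := by
    field_simp; ring
  rw [e2] at fin
  have f1 : n * ε ^ 2 ≤ 1/30000 := by nlinarith
  have f2 : 0 ≤ n * ε ^ 2 := by positivity
  have f3 : (n * ε ^ 2) * (A * T) ≤ 1 / 30000 * 1 := by
    apply mul_le_mul f1 (by linarith) (by positivity) (by norm_num)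
  have : 0 < X * η * A := by positivity
  nlinarith

end MSE

namespace MSE

open Filter Topology

theorem step1b {n : ℕ} (hn : 3 ≤ n) {R r0 ε : ℝ} (hR : 0 < R) {u : Eu n → ℝ} (h : Sol R u)
    (hr0 : R + 1 < r0) (hε0 : 0 < ε) (hε : ε * (100 * n) ≤ 1)
    (hg : ∀ w, r0 - 1 ≤ ‖w‖ → ‖gradient u w‖ ≤ ε)
    (hdecay : ∀ ε : ℝ, 0 < ε → ∃ R' : ℝ, ∀ x : Eu n, ‖x‖ ≥ R' → ‖gradient u x‖ ≤ ε)
    (z : Eu n) (hz : r0 ≤ ‖z‖) :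
    ‖gradient u z‖ ≤ (2 * ε * (r0 ^ 2) ^ (3/8:ℝ)) * (‖z‖ ^ 2) ^ (-(3/8):ℝ) := by
  set A := 2 * ε * (r0 ^ 2) ^ (3/8:ℝ) with hA
  have hr00 : 0 < r0 := by linarith
  have hA0 : 0 < A := by positivity
  set M := A * (‖z‖ ^ 2) ^ (-(3/8):ℝ) with hM
  have hM0 : 0 ≤ M := by positivity
  by_cases hp : gradient u z = 0
  · rw [hp, norm_zero]; exact hM0
  have hp0 : 0 < ‖gradient u z‖ := norm_pos_iff.2 hp
  set v : Eu n := (‖gradient u z‖)⁻¹ • gradient u z with hv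
  have hv1 : ‖v‖ = 1 := by rw [hv, norm_smul]; simp [hp0.ne']
  have key : ∀ t : ℝ, 0 < t → t ≤ 1/2 → u (z + (t/2) • v) - u (z - (t/2) • v) ≤ t * M := by
    intro t ht ht2
    apply le_of_forall_pos_le_add
    intro δ hδ
    have := step1a hn hR h hr0 hε0 hε hg hdecay t ht ht2 (t • v)
      (by rw [norm_smul, hv1, Real.norm_eq_abs, abs_of_pos ht, mul_one]) (δ / t) (by positivity) z hz
    have e1 : (1/2:ℝ) • (t • v) = (t/2) • v := by module
    rw [e1] at this
    refine this.trans (le_of_eq ?_)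
    simp only [bar, ← hA, hM]
    field_simp
    simp
    ring
  have hd : HasDerivAt (fun t : ℝ => u (z + (t/2) • v) - u (z - (t/2) • v)) ‖gradient u z‖ 0 := by
    have hu : HasFDerivAt u (fderiv ℝ u z) z := (h.diff z (by linarith)).hasFDerivAt
    have l1 : HasDerivAt (fun t : ℝ => z + (t/2) • v) ((1/2:ℝ) • v) 0 := by
      simpa using (((hasDerivAt_id (0:ℝ)).div_const 2).smul_const v).const_add z
    have l2 : HasDerivAt (fun t : ℝ => z - (t/2) • v) (-((1/2:ℝ) • v)) 0 := by
      simpa using (((hasDerivAt_id (0:ℝ)).div_const 2).smul_const v).const_sub z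
    have c1 := HasFDerivAt.comp_hasDerivAt_of_eq (0:ℝ) hu l1 (by simp)
    have c2 := HasFDerivAt.comp_hasDerivAt_of_eq (0:ℝ) hu l2 (by simp)
    have := c1.sub c2
    refine this.congr_deriv ?_
    have e : ∀ w, fderiv ℝ u z w = ⟪gradient u z, w⟫_ℝ := by
      intro w; simp [gradient]
    rw [map_neg, map_smul, e v, hv, real_inner_smul_right, real_inner_self_eq_norm_sq]
    field_simp
    simp
    ring
  have hs := hasDerivWithinAt_iff_tendsto_slope' (by simp) |>.1 (hd.hasDerivWithinAt (s := Set.Ioi 0))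
  refine le_of_tendsto hs ?_
  have : Set.Ioc (0:ℝ) (1/2) ∈ 𝓝[>] (0:ℝ) := Ioc_mem_nhdsGT (by norm_num)
  filter_upwards [this] with t ht
  rw [slope_def_field]
  have := key t ht.1 ht.2
  simp only [sub_zero, zero_div, zero_smul, add_zero, sub_self]
  rw [div_le_iff₀ ht.1]; linarith

theorem grad_decay {n : ℕ} (hn : 3 ≤ n) {R : ℝ} (hR : 0 < R) {u : Eu n → ℝ} (h : Sol R u)
    (hdecay : ∀ ε : ℝ, 0 < ε → ∃ R' : ℝ, ∀ x : Eu n, ‖x‖ ≥ R' → ‖gradient u x‖ ≤ ε) :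
    ∃ G r1 : ℝ, 0 < G ∧ R + 2 < r1 ∧ ∀ z : Eu n, r1 ≤ ‖z‖ → ∀ w : Eu n, ‖z‖ - 1 ≤ ‖w‖ →
      ‖gradient u w‖ ≤ G * (‖z‖ ^ 2) ^ (-(3/8):ℝ) := by
  have hn0 : (0:ℝ) < n := by exact_mod_cast (by omega : 0 < n)
  have hε0 : (0:ℝ) < 1 / (100 * n) := by positivity
  obtain ⟨R', hR'⟩ := hdecay (1 / (100 * n)) hε0
  set r0 := max (R + 2) (R' + 1) with hr0
  have a1 : R + 2 ≤ r0 := le_max_left _ _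
  have a2 : R' + 1 ≤ r0 := le_max_right _ _
  have hr00 : 0 < r0 := by linarith
  have st := step1b hn hR h (r0 := r0) (by linarith) hε0 (by field_simp; norm_num) (fun w hw => hR' w (by linarith)) hdecay
  set A := 2 * (1 / (100 * n)) * (r0 ^ 2) ^ (3/8:ℝ)
  have hA : 0 < A := by positivity
  refine ⟨A * (1/4) ^ (-(3/8):ℝ), r0 + 1, by positivity, by linarith, ?_⟩
  intro z hz w hw
  refine (st w (by linarith)).trans ?_
  rw [mul_assoc A, ← Real.mul_rpow (by norm_num) (by positivity)]
  refine mul_le_mul_of_nonneg_left ?_ hA.le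
  have hz0 : 0 < ‖z‖ := by linarith
  apply Real.rpow_le_rpow_of_nonpos (by positivity) _ (by norm_num)
  have : ‖z‖ / 2 ≤ ‖w‖ := by linarith
  have := pow_le_pow_left₀ (by positivity) this 2
  linarith

theorem exists_perp {n : ℕ} (hn : 3 ≤ n) (e z : Eu n) :
    ∃ w : Eu n, ‖w‖ = 1 ∧ ⟪e, w⟫_ℝ = 0 ∧ 0 ≤ ⟪z, w⟫_ℝ := by
  have : ∃ w : Eu n, ‖w‖ = 1 ∧ ⟪e, w⟫_ℝ = 0 := by
    have hne : (ℝ ∙ e)ᗮ ≠ ⊥ := by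
      intro hb
      have h1 := Submodule.finrank_add_finrank_orthogonal (ℝ ∙ e)
      rw [hb, finrank_bot] at h1
      have h2 := finrank_span_le_card (R := ℝ) ({e} : Set (Eu n))
      simp at h1
      rw [Set.toFinset_singleton, Finset.card_singleton] at h2
      omega
    obtain ⟨w, hw, hw0⟩ := Submodule.exists_mem_ne_zero_of_ne_bot hne
    refine ⟨(‖w‖)⁻¹ • w, by rw [norm_smul]; simp [hw0], ?_⟩
    rw [real_inner_smul_right, Submodule.mem_orthogonal_singleton_iff_inner_right.1 hw, mul_zero]
  obtain ⟨w, h1, h2⟩ := this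
  rcases le_total 0 ⟪z, w⟫_ℝ with h3 | h3
  · exact ⟨w, h1, h2, h3⟩
  · exact ⟨-w, by simpa, by simpa, by simpa⟩

theorem path_bound {n : ℕ} (hn : 3 ≤ n) {R ε : ℝ} {u : Eu n → ℝ} (h : Sol R u)
    (e z : Eu n) (he : ‖e‖ = 1) (hρ : R < ‖z‖) (hc : 0 ≤ ⟪e, z⟫_ℝ)
    (hg : ∀ w, ‖z‖ ≤ ‖w‖ → ‖gradient u w‖ ≤ ε) :
    u z - u (rf e z) ≤ 6 * ⟪e, z⟫_ℝ * ε := by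
  obtain ⟨w, w1, w2, w3⟩ := exists_perp hn e z
  set c := ⟪e, z⟫_ℝ with hcd
  have w2' : ⟪w, e⟫_ℝ = 0 := by rw [real_inner_comm]; exact w2
  have hze : ⟪z, e⟫_ℝ = c := by rw [real_inner_comm]
  have hee : ⟪e, e⟫_ℝ = 1 := by rw [real_inner_self_eq_norm_sq, he]; norm_num
  have hww : ⟪w, w⟫_ℝ = 1 := by rw [real_inner_self_eq_norm_sq, w1]; norm_num
  have hwz : ⟪w, z⟫_ℝ = ⟪z, w⟫_ℝ := real_inner_comm _ _
  have gen : ∀ a b : ℝ, 0 ≤ a → 0 ≤ a ^ 2 - 2 * b * c + b ^ 2 → ‖z‖ ≤ ‖z + a • w - b • e‖ := by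
    intro a b ha hb
    apply le_of_sq_le_sq _ (norm_nonneg _)
    rw [← real_inner_self_eq_norm_sq, ← real_inner_self_eq_norm_sq]
    simp only [inner_sub_left, inner_sub_right, inner_add_left, inner_add_right,
      real_inner_smul_left, real_inner_smul_right, w2, w2', hze, hee, hww, hwz, ← hcd]
    have := mul_nonneg ha w3
    nlinarith
  have s1 := h.mv hρ hg (z + (2*c) • w) z (by
    rintro v ⟨a, b, ha, hb, hab, rfl⟩
    have : a • (z + (2*c) • w) + b • z = z + (a * (2 * c)) • w - (0:ℝ) • e := by
      rw [← eq_sub_iff_add_eq'] at hab; subst hab; module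
    rw [this]; apply gen _ _ (by positivity); nlinarith [sq_nonneg (a * (2*c))])
  have s2 := h.mv hρ hg (z + (2*c) • w - (2*c) • e) (z + (2*c) • w) (by
    rintro v ⟨a, b, ha, hb, hab, rfl⟩
    have : a • (z + (2*c) • w - (2*c) • e) + b • (z + (2*c) • w) = z + (2 * c) • w - (a * (2 * c)) • e := by
      rw [← eq_sub_iff_add_eq'] at hab; subst hab; module
    rw [this]; apply gen _ _ (by positivity)
    have : 0 ≤ c ^ 2 * ((1 - a) * 4 + 4 * a ^ 2) := by
      have : 0 ≤ 1 - a := by linarith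
      positivity
    nlinarith)
  have s3 := h.mv hρ hg (z - (2*c) • e) (z + (2*c) • w - (2*c) • e) (by
    rintro v ⟨a, b, ha, hb, hab, rfl⟩
    have : a • (z - (2*c) • e) + b • (z + (2*c) • w - (2*c) • e) = z + (b * (2 * c)) • w - (2 * c) • e := by
      rw [← eq_sub_iff_add_eq] at hab; subst hab; module
    rw [this]; apply gen _ _ (by positivity); nlinarith [sq_nonneg (b * (2*c))])
  have e1 : z - (z + (2*c) • w) = -((2*c) • w) := by module
  have e2 : z + (2*c) • w - (z + (2*c) • w - (2*c) • e) = (2*c) • e := by module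
  have e3 : z + (2*c) • w - (2*c) • e - (z - (2*c) • e) = (2*c) • w := by module
  rw [e1, norm_neg] at s1
  rw [e2] at s2
  rw [e3] at s3
  have hc2 : |2 * c| = 2 * c := abs_of_nonneg (by linarith)
  rw [norm_smul, Real.norm_eq_abs, hc2] at s1 s2 s3
  rw [w1] at s1 s3
  rw [he] at s2
  rw [rf_apply, ← hcd]
  have := le_abs_self (u z - u (z + (2*c) • w))
  have := le_abs_self (u (z + (2*c) • w) - u (z + (2*c) • w - (2*c) • e))
  have := le_abs_self (u (z + (2*c) • w - (2*c) • e) - u (z - (2*c) • e))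
  linarith

end MSE

namespace MSE

open Filter Topology

theorem T_facts (r G : ℝ) (hr : 1 ≤ r) (hG : 0 < G) :
    let T := (r ^ 2) ^ (-(1/4):ℝ)
    0 < T ∧ T ≤ 1 ∧ r * T ^ 2 = 1 ∧ (r ^ 2) ^ (-(1/4) - 1:ℝ) = T ^ 5 ∧
      (G * (r ^ 2) ^ (-(3/8):ℝ)) ^ 2 = G ^ 2 * T ^ 3 ∧ G * (r ^ 2) ^ (-(3/8):ℝ) ≤ G * T := by
  intro T
  have hr0 : 0 < r := by linarith
  have hs : 0 < r ^ 2 := by positivity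
  have hs1 : 1 ≤ r ^ 2 := by nlinarith
  have pw : ∀ k : ℕ, T ^ k = (r ^ 2) ^ (-(1/4) * k:ℝ) := by
    intro k; rw [Real.rpow_mul hs.le, Real.rpow_natCast]
  refine ⟨by positivity, Real.rpow_le_one_of_one_le_of_nonpos hs1 (by norm_num), ?_, ?_, ?_, ?_⟩
  · rw [pw, ← Real.rpow_natCast r 2, ← Real.rpow_mul hr0.le]
    norm_num
    rw [Real.rpow_neg_one]; field_simp
  · rw [pw]; norm_num
  · rw [mul_pow, pw, ← Real.rpow_natCast ((r ^ 2) ^ (-(3/8):ℝ)), ← Real.rpow_mul hs.le]; norm_num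
  · refine mul_le_mul_of_nonneg_left ?_ hG.le
    exact Real.rpow_le_rpow_of_exponent_le hs1 (by norm_num)

theorem num_a {N G K r0 : ℝ} (hN : 0 ≤ N) (hr0' : 8 * (9 * N * G ^ 2 * (K ^ 2 + 5) + 2 * G ^ 2 + 1) ≤ r0) :
    360 * (N * G ^ 2) ≤ r0 := by
  have : 0 ≤ N * G ^ 2 * K ^ 2 := by positivity
  nlinarith

theorem num_b {r0 r T : ℝ} (h : r0 ≤ r) (h2 : r * T ^ 2 = 1) : T ^ 2 * r0 ≤ 1 := by
  nlinarith [sq_nonneg T]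

theorem num_c {N G T r0 ε : ℝ} (hN : 3 ≤ N) (T0 : 0 < T) (T1 : T ≤ 1) (Tε : ε ^ 2 = G ^ 2 * T ^ 3)
    (hnG : 360 * (N * G ^ 2) ≤ r0) (hTr : T ^ 2 * r0 ≤ 1) :
    N * ε ^ 2 ≤ 1 / 360 ∧ ε ≤ 1/4 ∧ ε ^ 2 ≤ G ^ 2 * T := by
  have hT3 : T ^ 3 ≤ T ^ 2 := pow_le_pow_of_le_one T0.le T1 (by norm_num)
  have hnε : N * ε ^ 2 ≤ 1 / 360 := by
    rw [Tε]
    have h1 : N * G ^ 2 * T ^ 3 ≤ N * G ^ 2 * T ^ 2 := by gcongr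
    have h2 : 360 * (N * G ^ 2) * T ^ 2 ≤ r0 * T ^ 2 := by gcongr
    linarith
  refine ⟨hnε, ?_, ?_⟩
  · by_contra hc
    push Not at hc
    nlinarith
  · rw [Tε]
    have : T ^ 3 ≤ T ^ 1 := pow_le_pow_of_le_one T0.le T1 (by norm_num)
    rw [pow_one] at this
    gcongr

theorem num_d {G K r0 : ℝ} (hG : 0 < G) (hr01 : 1 ≤ r0) (hK : K = 12 * G + G ^ 2 + 1) : G ^ 2 ≤ K * r0 := by
  have : 0 ≤ K := by rw [hK]; positivity
  nlinarith

theorem num_e {G K r0 T c ε μ : ℝ} (hG : 0 < G) (hr01 : 1 ≤ r0) (hK : K = 12 * G + G ^ 2 + 1)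
    (hcz : c ≤ r0) (hc : 0 < c) (TG : ε ≤ G * T) (T0 : 0 < T) (hμ0 : 0 < μ) (hε0 : 0 < ε) (hε2 : ε ^ 2 ≤ G ^ 2 * T)
    (hQ : T * (K * r0 + μ * c) < 6 * c * ε + ε ^ 2 / 2) : False := by
  have h1 : 6 * c * ε ≤ 6 * r0 * (G * T) := by gcongr
  have h2 : T * (K * r0) = 12 * G * r0 * T + G ^ 2 * (r0 * T) + r0 * T := by rw [hK]; ring
  have h3 : 0 ≤ T * (μ * c) := by positivity
  have h4 : G ^ 2 * T ≤ G ^ 2 * (r0 * T) := by gcongr; nlinarith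
  have h5 : 0 < G * r0 * T := by positivity
  have h6 : 0 < r0 * T := by positivity
  have h7 : 0 < G ^ 2 * T := by positivity
  linarith

theorem num_f {T A μ c ε : ℝ} (hc : 0 ≤ c) (h : 6 * ε ≤ μ * T) (hεA : ε ^ 2 ≤ T * A) (hTA : 0 < T * A)
    (hQ : T * (A + μ * c) < 6 * c * ε + ε ^ 2 / 2) : False := by
  have := mul_le_mul_of_nonneg_left h hc
  linarith

theorem num_g {N G K T r0 A ε D : ℝ} (hN : 3 ≤ N) (T0 : 0 < T) (Tε : ε ^ 2 = G ^ 2 * T ^ 3) (hTr : T ^ 2 * r0 ≤ 1)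
    (hr0 : 0 < r0) (hD0 : 0 ≤ D)
    (hA : A = K * r0) (s3 : D ≤ (1/2) * A * T ^ 3 + (3/2) * T) :
    9 * N * ε ^ 2 * D ^ 2 ≤ T ^ 5 * (9 * N * G ^ 2 * (K ^ 2 + 5)) := by
  have s4 : D ^ 2 ≤ (1/2) * A ^ 2 * T ^ 6 + (9/2) * T ^ 2 := by
    have h1 : D ^ 2 ≤ ((1/2) * A * T ^ 3 + (3/2) * T) ^ 2 := by gcongr
    have := sq_nonneg ((1/2) * A * T ^ 3 - (3/2) * T)
    linarith
  have s5 : 9 * N * ε ^ 2 * D ^ 2 ≤ 9 * N * (G ^ 2 * T ^ 3) * ((1/2) * A ^ 2 * T ^ 6 + (9/2) * T ^ 2) := by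
    rw [Tε]; gcongr
  have s6 : A ^ 2 * T ^ 4 ≤ K ^ 2 := by
    have : A ^ 2 * T ^ 4 = K ^ 2 * (T ^ 2 * r0) ^ 2 := by rw [hA]; ring
    rw [this]
    have : (T ^ 2 * r0) ^ 2 ≤ 1 := pow_le_one₀ (by positivity) hTr
    exact mul_le_of_le_one_right (sq_nonneg K) this
  refine s5.trans ?_
  have : 9 * N * (G ^ 2 * T ^ 3) * ((1/2) * A ^ 2 * T ^ 6 + (9/2) * T ^ 2)
      = T ^ 5 * (9 * N * G ^ 2 * ((1/2) * (A ^ 2 * T ^ 4) + 9/2)) := by ring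
  rw [this]
  have : (1/2) * (A ^ 2 * T ^ 4) + 9/2 ≤ K ^ 2 + 5 := by linarith [sq_nonneg K]
  gcongr

theorem num_h {N G T r A ε μ c : ℝ} (hN : 3 ≤ N) (T1 : T ≤ 1) (T2 : r * T ^ 2 = 1) (Tε : ε ^ 2 = G ^ 2 * T ^ 3)
    (hnε : N * ε ^ 2 ≤ 1 / 360) (hA : 0 < A) (hμ0 : 0 < μ) (hμ1 : μ ≤ 1) (hc : 0 < c) (T0 : 0 < T) :
    (A + μ * c) * (2 * (1/4)) * (-(N * (1 - ε ^ 2)) + 2 * (1/4 + 1)) - 4 * (1/4) * μ * (c - 2 * ε ^ 2 * r)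
      ≤ -(A / 8) + 2 * G ^ 2 := by
  have h1 : ε ^ 2 * r = G ^ 2 * T * (r * T ^ 2) := by rw [Tε]; ring
  rw [T2, mul_one] at h1
  have h2 : μ * (ε ^ 2 * r) ≤ 1 * (G ^ 2 * 1) := by rw [h1]; gcongr
  have h3 : 0 ≤ μ * c := by positivity
  have h4 : -(N * (1 - ε ^ 2)) + 2 * (1/4 + 1) ≤ -(1/4:ℝ) := by linarith
  have h5 : (A + μ * c) * (2 * (1/4)) * (-(N * (1 - ε ^ 2)) + 2 * (1/4 + 1)) ≤ (A + μ * c) * (2 * (1/4)) * (-(1/4:ℝ)) := by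
    gcongr
  linarith

theorem num_i {T A μ c r : ℝ} (T0 : 0 < T) (T2 : r * T ^ 2 = 1) (hA : 0 < A) (hμ0 : 0 < μ) (hμ1 : μ ≤ 1)
    (hc : 0 < c) (hcr : c ≤ r) : |-(2 * (1/4)) * T ^ 5 * (A + μ * c)| * r + μ * T * 1 ≤ (1/2) * A * T ^ 3 + (3/2) * T := by
  have hr : 0 < r := hc.trans_le hcr
  have e1 : -(2 * (1/4)) * T ^ 5 * (A + μ * c) = -((1/2) * T ^ 5 * (A + μ * c)) := by ring
  rw [e1, abs_neg, abs_of_pos (by positivity)]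
  have e2 : 1 / 2 * T ^ 5 * (A + μ * c) * r = (1/2) * A * T ^ 3 * (r * T ^ 2) + (1/2) * (μ * (c * T ^ 2)) * T ^ 3 * r := by ring
  have e3 : (1/2) * (μ * (c * T ^ 2)) * T ^ 3 * r ≤ (1/2) * (1 * (r * T ^ 2)) * T ^ 3 * r := by gcongr
  have e4 : (1/2) * (1 * (r * T ^ 2)) * T ^ 3 * r = (1/2) * T * (r * T ^ 2) ^ 2 := by ring
  rw [e4, T2] at e3
  rw [e2, T2]
  have e5 : μ * T ≤ 1 * T := by gcongr
  linarith

set_option maxHeartbeats 2000000 in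
theorem step2 {n : ℕ} (hn : 3 ≤ n) {R r0 G K : ℝ} (hR : 0 < R) {u : Eu n → ℝ} (h : Sol R u)
    (hr0 : R + 2 < r0) (hG : 0 < G)
    (hg : ∀ z : Eu n, r0 ≤ ‖z‖ → ∀ w : Eu n, ‖z‖ - 1 ≤ ‖w‖ →
      ‖gradient u w‖ ≤ G * (‖z‖ ^ 2) ^ (-(3/8):ℝ))
    (hK : K = 12 * G + G ^ 2 + 1) (hr0' : 8 * (9 * n * G ^ 2 * (K ^ 2 + 5) + 2 * G ^ 2 + 1) ≤ r0)
    (e : Eu n) (he : ‖e‖ = 1) (μ : ℝ) (hμ0 : 0 < μ) (hμ1 : μ ≤ 1)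
    (z0 : Eu n) (hz0 : r0 ≤ ‖z0‖) (hc0 : 0 ≤ ⟪e, z0⟫_ℝ) :
    u z0 - u (rf e z0) ≤ bar (1/4) 0 (K * r0) μ e z0 := by
  by_contra hcon
  push Not at hcon
  have hnR : (3:ℝ) ≤ n := by exact_mod_cast hn
  have hK1 : 1 ≤ K := by nlinarith
  have hr01 : 1 ≤ r0 := by linarith
  have hA0 : 0 < K * r0 := by positivity
  set A := K * r0 with hA
  have hnG : 360 * (n * G ^ 2) ≤ r0 := num_a (by positivity) hr0'
  obtain ⟨L0, hL0⟩ : ∃ L0 : ℝ, ∀ r : ℝ, L0 ≤ r → 1 ≤ r → 6 * (G * (r ^ 2) ^ (-(3/8):ℝ)) ≤ μ * (r ^ 2) ^ (-(1/4):ℝ) := by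
    have ht : Tendsto (fun r : ℝ => r ^ (1/4:ℝ)) atTop atTop := tendsto_rpow_atTop (by norm_num)
    obtain ⟨L0, hL0⟩ := (ht.eventually_ge_atTop (6 * G / μ)).exists_forall_of_atTop
    refine ⟨L0, fun r hr hr1 => ?_⟩
    have h1 := hL0 r hr
    rw [div_le_iff₀ hμ0] at h1
    have hr00 : 0 < r := by linarith
    have e1 : (r ^ 2) ^ (-(1/4):ℝ) = r ^ (1/4:ℝ) * (r ^ 2) ^ (-(3/8):ℝ) := by
      rw [← Real.rpow_natCast r 2, ← Real.rpow_mul hr00.le, ← Real.rpow_mul hr00.le, ← Real.rpow_add hr00]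
      norm_num
    rw [e1]
    have : 0 < (r ^ 2) ^ (-(3/8):ℝ) := by positivity
    nlinarith
  set Lr := max (‖z0‖ + 1) L0 with hLr
  set F : Eu n × Eu n → ℝ := fun w => u (w.1 + (1/2:ℝ) • w.2) - (fun y => u (rf e y)) (w.1 - (1/2:ℝ) • w.2)
      - bar (1/4) 0 A μ e w.1 - ‖w.2 - 0‖ ^ 2 / (2 * 1) with hF
  set Kc : Set (Eu n × Eu n) := (Metric.closedBall 0 Lr ∩ {w | r0 ≤ ‖w‖ ∧ 0 ≤ ⟪e, w⟫_ℝ}) ×ˢ Metric.closedBall 0 1 with hKc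
  have hKcc : IsCompact Kc := by
    apply IsCompact.prod
    · refine (isCompact_closedBall 0 Lr).inter_right ?_
      have c1 : IsClosed {w : Eu n | r0 ≤ ‖w‖} := isClosed_le continuous_const continuous_norm
      have c2 : IsClosed {w : Eu n | 0 ≤ ⟪e, w⟫_ℝ} := isClosed_le continuous_const (by fun_prop)
      exact c1.inter c2
    · exact isCompact_closedBall _ _
  have hnorm1 : ∀ w k : Eu n, ‖k‖ ≤ 1 → ‖w‖ - 1 ≤ ‖w + (1/2:ℝ) • k‖ ∧ ‖w‖ - 1 ≤ ‖w - (1/2:ℝ) • k‖ := by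
    intro w k hk
    have e : ‖(1/2:ℝ) • k‖ ≤ 1/2 := by rw [norm_smul]; norm_num; linarith
    have h1 := norm_sub_norm_le w (-((1/2:ℝ) • k))
    have h2 := norm_sub_norm_le w ((1/2:ℝ) • k)
    rw [norm_neg, sub_neg_eq_add] at h1
    constructor <;> linarith
  have hFc : ContinuousOn F Kc := by
    rintro ⟨w, k⟩ ⟨⟨hw1, hw2, hw3⟩, hk⟩
    apply ContinuousAt.continuousWithinAt
    have hk1 : ‖k‖ ≤ 1 := by simpa using hk
    obtain ⟨m1, m2⟩ := hnorm1 w k hk1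
    have c1 : ContinuousAt u (w + (1/2:ℝ) • k) := (h.diff _ (by linarith)).continuousAt
    have c2 : ContinuousAt u (rf e (w - (1/2:ℝ) • k)) := (h.diff _ (by rw [rf_norm _ _ he]; linarith)).continuousAt
    have c3 : ContinuousAt (bar (1/4) 0 A μ e) w := by
      apply bar_continuousAt
      rintro rfl
      simp only [norm_zero] at hw2; linarith
    have d1 : ContinuousAt (fun w : Eu n × Eu n => u (w.1 + (1/2:ℝ) • w.2)) (w, k) :=
      ContinuousAt.comp (f := fun w : Eu n × Eu n => w.1 + (1/2:ℝ) • w.2) c1 (by fun_prop)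
    have d2 : ContinuousAt (fun w : Eu n × Eu n => u (rf e (w.1 - (1/2:ℝ) • w.2))) (w, k) :=
      ContinuousAt.comp (f := fun w : Eu n × Eu n => rf e (w.1 - (1/2:ℝ) • w.2)) c2 (by fun_prop)
    have d3 : ContinuousAt (fun w : Eu n × Eu n => bar (1/4) 0 A μ e w.1) (w, k) :=
      ContinuousAt.comp (x := (w, k)) (f := fun w : Eu n × Eu n => w.1) (g := bar (1/4) 0 A μ e) c3 (by fun_prop)
    exact ((d1.sub d2).sub d3).sub (by fun_prop)
  have hmem0 : (z0, (0 : Eu n)) ∈ Kc := by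
    refine ⟨⟨?_, hz0, hc0⟩, by simp⟩
    simp only [mem_closedBall_iff_norm, sub_zero]
    exact (by linarith : ‖z0‖ ≤ ‖z0‖ + 1).trans (le_max_left _ _)
  obtain ⟨⟨z, k⟩, hzk, hmax⟩ := hKcc.exists_isMaxOn ⟨_, hmem0⟩ hFc
  have hpos : 0 < F (z, k) := by
    have h1 : F (z0, 0) ≤ F (z, k) := hmax hmem0
    have h2 : 0 < F (z0, 0) := by
      simp only [hF, sub_self, norm_zero]
      simp
      linarith
    linarith
  obtain ⟨⟨hz1, hz2, hz3⟩, hk⟩ := hzk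
  have hmemz : (z, (0 : Eu n)) ∈ Kc := ⟨⟨hz1, hz2, hz3⟩, by simp⟩
  have hmz : F (z, 0) ≤ F (z, k) := hmax hmemz
  simp only [mem_closedBall_iff_norm, sub_zero] at hz1 hk
  obtain ⟨m1, m2⟩ := hnorm1 z k hk
  have hr1 : 1 ≤ ‖z‖ := by linarith
  have hgz := hg z hz2
  obtain ⟨T0, T1, T2, T5, Tε, TG⟩ := T_facts ‖z‖ G hr1 hG
  set T := (‖z‖ ^ 2) ^ (-(1/4):ℝ) with hT
  have hL := hL0 ‖z‖
  set ε := G * (‖z‖ ^ 2) ^ (-(3/8):ℝ) with hεd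
  rw [← hT] at hL
  have hε0 : 0 < ε := by rw [hεd]; have : (0:ℝ) < ‖z‖ ^ 2 := by positivity
                         positivity
  have hTr : T ^ 2 * r0 ≤ 1 := num_b hz2 T2
  obtain ⟨hnε, hε4, hε2⟩ := num_c hnR T0 T1 Tε hnG hTr
  set c := ⟪e, z⟫_ℝ with hc
  have hcz : c ≤ ‖z‖ := by
    have := real_inner_le_norm e z
    rwa [he, one_mul] at this
  have hpath : u z - u (rf e z) ≤ 6 * c * ε :=
    path_bound hn h e z he (by linarith) hz3 (fun w hw => hgz w (by linarith))
  have hball : ∀ y : Eu n, ‖y‖ = ‖z‖ → ∀ v : Eu n, ‖v‖ ≤ 1/2 → |u (y + v) - u y| ≤ ε * ‖v‖ := by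
    intro y hy v hv
    have := h.mv (ρ := ‖z‖ - 1) (by linarith) hgz y (y + v) (by
      intro x hx
      have hcv : Convex ℝ (Metric.closedBall y (1/2)) := convex_closedBall _ _
      have h1 : y ∈ Metric.closedBall y (1/2) := by simp
      have h2 : y + v ∈ Metric.closedBall y (1/2) := by
        rw [mem_closedBall_iff_norm]; simpa using hv
      have h3 := hcv.segment_subset h1 h2 hx
      rw [mem_closedBall_iff_norm'] at h3
      have := norm_sub_norm_le y x
      linarith)
    simpa using this
  have hhalf : ‖(1/2:ℝ) • k‖ = ‖k‖ / 2 := by rw [norm_smul]; norm_num; ring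
  have b1 := (abs_le.1 (hball z rfl ((1/2:ℝ) • k) (by linarith))).2
  have b2 := (abs_le.1 (hball (rf e z) (rf_norm e z he) (-(rf e ((1/2:ℝ) • k))) (by rw [norm_neg, rf_norm _ _ he]; linarith))).1
  rw [norm_neg, rf_norm _ _ he] at b2
  rw [hhalf] at b1 b2
  have erf : rf e z + -(rf e ((1/2:ℝ) • k)) = rf e (z - (1/2:ℝ) • k) := by rw [map_sub]; abel
  rw [erf] at b2
  have hFe : F (z, k) = u (z + (1/2:ℝ) • k) - u (rf e (z - (1/2:ℝ) • k)) - T * (A + μ * c) - ‖k‖ ^ 2 / 2 := by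
    simp only [hF, bar, sub_zero, zero_add, mul_one, ← hT, ← hc]
  have hFe0 : F (z, 0) = u z - u (rf e z) - T * (A + μ * c) := by
    simp only [hF, bar, sub_zero, zero_add, mul_one, smul_zero, add_zero, norm_zero, ← hT, ← hc]
    norm_num
  have i1 : ‖k‖ < 1 := by
    refine lt_of_le_of_ne hk fun hke => ?_
    rw [hke] at hFe b1 b2
    linarith
  have hQ : T * (A + μ * c) < 6 * c * ε + ε ^ 2 / 2 := by
    have := two_mul_le_add_sq ‖k‖ ε
    linarith
  have hGA : G ^ 2 ≤ A := num_d hG hr01 hK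
  have hTA : 0 < T * A := by positivity
  have hεA : ε ^ 2 ≤ T * A := by
    have : G ^ 2 * T ≤ A * T := by gcongr
    linarith
  have i2 : 0 < c := by
    refine lt_of_le_of_ne hz3 fun hce => ?_
    rw [← hce] at hQ
    linarith
  have i3 : ‖z‖ < Lr := by
    refine lt_of_le_of_ne hz1 fun hze => ?_
    have := hL (by rw [hze]; exact le_max_right _ _) hr1
    exact num_f hz3 this hεA hTA hQ
  have i4 : r0 < ‖z‖ := by
    refine lt_of_le_of_ne hz2 fun hze => ?_
    rw [← hze] at hcz
    exact num_e hG hr01 hK hcz i2 TG T0 hμ0 hε0 hε2 hQ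
  have hloc : IsLocalMax F (z, k) := by
    apply hmax.isLocalMax
    have hop : IsOpen ((Metric.ball 0 Lr ∩ {w : Eu n | r0 < ‖w‖ ∧ 0 < ⟪e, w⟫_ℝ}) ×ˢ Metric.ball (0 : Eu n) 1) := by
      refine (Metric.isOpen_ball.inter ?_).prod Metric.isOpen_ball
      have c1 : IsOpen {w : Eu n | r0 < ‖w‖} := isOpen_lt continuous_const continuous_norm
      have c2 : IsOpen {w : Eu n | 0 < ⟪e, w⟫_ℝ} := isOpen_lt continuous_const (by fun_prop)
      exact c1.inter c2
    apply mem_of_superset (hop.mem_nhds (x := (z, k)) ⟨⟨by simpa using i3, i4, i2⟩, by simpa using i1⟩)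
    apply Set.prod_mono
    · refine Set.inter_subset_inter Metric.ball_subset_closedBall ?_
      rintro w ⟨h1, h2⟩
      exact ⟨h1.le, h2.le⟩
    · exact Metric.ball_subset_closedBall
  have hz00 : z ≠ 0 := by rintro rfl; simp at hr1; linarith
  have hp := hgz _ m1
  have hq := hgz (rf e (z - (1/2:ℝ) • k)) (by rw [rf_norm _ _ he]; exact m2)
  obtain ⟨t1, t2⟩ := two_point (h.mj _ (by linarith)) (MJ.refl he (h.mj _ (by rw [rf_norm _ _ he]; linarith)))
    (bar_LJ (1/4) 0 A μ e z hz00) hloc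
  set p := gradient u (z + (1/2:ℝ) • k)
  set q := rf e (gradient u (rf e (z - (1/2:ℝ) • k)))
  have hq' : ‖q‖ ≤ ε := by rw [rf_norm _ _ he]; exact hq
  have s1 := bar_sum (1/4) A μ ε e z p q hz00 (by norm_num) hμ0.le he.le (by rw [← hc]; positivity) hp hq'
  have s2 := Bm_diff p q ε hp hq' (by linarith)
  have s3 : ‖p - q‖ ≤ (1/2) * A * T ^ 3 + (3/2) * T := by
    rw [t1]
    refine (norm_add_le _ _).trans ?_
    rw [norm_smul, norm_smul, he, Real.norm_eq_abs, Real.norm_eq_abs, abs_of_pos (by positivity : 0 < μ * (‖z‖ ^ 2) ^ (-(1/4):ℝ)),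
      T5, ← hc, ← hT]
    exact num_i T0 T2 hA0 hμ0 hμ1 i2 hcz
  have s7 := num_g hnR T0 Tε hTr (by linarith) (norm_nonneg _) hA s3
  rw [T5, ← hc] at s1
  have s8 : (A + μ * c) * (2 * (1/4)) * (-(n * (1 - ε ^ 2)) + 2 * (1/4 + 1)) - 4 * (1/4) * μ * (c - 2 * ε ^ 2 * ‖z‖)
      ≤ -(A / 8) + 2 * G ^ 2 := num_h hnR T1 T2 Tε hnε hA0 hμ0 hμ1 i2 T0
  have s9 : T ^ 5 * ((A + μ * c) * (2 * (1/4)) * (-(n * (1 - ε ^ 2)) + 2 * (1/4 + 1)) - 4 * (1/4) * μ * (c - 2 * ε ^ 2 * ‖z‖))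
     ≤ T ^ 5 * (-(A / 8) + 2 * G ^ 2) := by gcongr
  have s10 : 0 ≤ T ^ 5 * (-(A / 8) + 2 * G ^ 2) + T ^ 5 * (9 * n * G ^ 2 * (K ^ 2 + 5)) := by
    rw [inv_one, one_mul] at t2
    refine t2.trans (add_le_add ?_ (s2.trans s7))
    refine le_trans ?_ s9
    rw [T5, ← hc] at *
    exact s1
  have s11 : r0 ≤ A := le_mul_of_one_le_left (by linarith) hK1
  have : T ^ 5 * (-(A / 8) + 2 * G ^ 2) + T ^ 5 * (9 * n * G ^ 2 * (K ^ 2 + 5)) < 0 := by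
    rw [← mul_add]
    apply mul_neg_of_pos_of_neg (by positivity)
    linarith
  linarith

end MSE

namespace MSE

open Filter Topology

theorem sphere_osc {n : ℕ} (hn : 3 ≤ n) {R : ℝ} (hR : 0 < R) {u : Eu n → ℝ} (h : Sol R u)
    (hdecay : ∀ ε : ℝ, 0 < ε → ∃ R' : ℝ, ∀ x : Eu n, ‖x‖ ≥ R' → ‖gradient u x‖ ≤ ε) :
    ∃ r0 B : ℝ, R + 2 < r0 ∧ 0 < B ∧ ∀ z z' : Eu n, r0 ≤ ‖z‖ → ‖z‖ = ‖z'‖ →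
      u z - u z' ≤ B * (‖z‖ ^ 2) ^ (-(1/4):ℝ) := by
  obtain ⟨G, r1, hG, hr1, hg⟩ := grad_decay hn hR h hdecay
  set K := 12 * G + G ^ 2 + 1 with hK
  set r0 := max r1 (8 * (9 * n * G ^ 2 * (K ^ 2 + 5) + 2 * G ^ 2 + 1)) with hr0
  have a1 : r1 ≤ r0 := le_max_left _ _
  have a2 : 8 * (9 * n * G ^ 2 * (K ^ 2 + 5) + 2 * G ^ 2 + 1) ≤ r0 := le_max_right _ _
  have hr00 : 0 < r0 := by linarith
  have hK0 : 0 < K := by positivity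
  refine ⟨r0, K * r0, by linarith, by positivity, ?_⟩
  intro z z' hz hzz
  have hT : 0 < (‖z‖ ^ 2) ^ (-(1/4):ℝ) := by
    have : 0 < ‖z‖ := by linarith
    positivity
  by_cases hne : z = z'
  · rw [hne, sub_self, ← hne]; positivity
  have hd : 0 < ‖z - z'‖ := norm_pos_iff.2 (sub_ne_zero.2 hne)
  set d := ‖z - z'‖ with hdd
  set e : Eu n := d⁻¹ • (z - z') with he
  have he1 : ‖e‖ = 1 := by rw [he, norm_smul, ← hdd, Real.norm_eq_abs, abs_of_pos (by positivity), inv_mul_cancel₀ hd.ne']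
  have hin : ⟪z - z', z⟫_ℝ = d ^ 2 / 2 := by
    have h1 := norm_sub_sq_real z z'
    rw [inner_sub_left, real_inner_self_eq_norm_sq, real_inner_comm, hdd, h1, hzz]; ring
  have hez : ⟪e, z⟫_ℝ = d / 2 := by
    rw [he, real_inner_smul_left, hin]; field_simp
  have hrf : rf e z = z' := by
    rw [rf_apply, hez, he, smul_smul]
    have : 2 * (d / 2) * d⁻¹ = 1 := by field_simp
    rw [this]; module
  apply le_of_forall_pos_le_add
  intro δ hδ
  set T := (‖z‖ ^ 2) ^ (-(1/4):ℝ) with hTd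
  have hq : 0 < δ / (T * d) := by positivity
  have := step2 hn hR h (r0 := r0) (by linarith) hG (fun z hz => hg z (by linarith)) hK a2 e he1
    (min 1 (δ / (T * d))) (by positivity) (min_le_left _ _) z hz (by rw [hez]; positivity)
  rw [hrf] at this
  refine this.trans ?_
  simp only [bar, ← hTd, hez]
  have h2 : T * (min 1 (δ / (T * d)) * (d / 2)) ≤ T * ((δ / (T * d)) * (d / 2)) := by
    gcongr; exact min_le_right _ _
  have h3 : T * ((δ / (T * d)) * (d / 2)) = δ / 2 := by field_simp
  linarith

theorem Bm_sum_norm {n : ℕ} (p : Eu n) :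
    ∑ i, ‖Bm p (bb n i)‖ ^ 2 = n - (1 + ‖p‖ ^ 2)⁻¹ * ‖p‖ ^ 2 := by
  have := sum_rank_one (innerSL ℝ) p (ss p)
  rw [ss_key] at this
  have h3 : ∀ i, ‖bb n i‖ = 1 := fun i => (bb n).norm_eq_one i
  have h4 : ∀ v w : Eu n, innerSL ℝ v w = ⟪v, w⟫_ℝ := fun v w => rfl
  simp only [h4, real_inner_self_eq_norm_sq, h3] at this
  unfold Bm
  rw [this]
  simp

theorem Bm_sum_z {n : ℕ} (z : Eu n) (l : ℝ) :
    ∑ i, ⟪z, Bm (l • z) (bb n i)⟫_ℝ ^ 2 = ‖z‖ ^ 2 * (1 - (1 + ‖l • z‖ ^ 2)⁻¹ * ‖l • z‖ ^ 2) := by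
  have h1 : ∑ i, ⟪z, Bm (l • z) (bb n i)⟫_ℝ ^ 2 = ‖Bm (l • z) z‖ ^ 2 := by
    simp only [Bm_symm, pow_two (inner ℝ _ _), sum_sq, real_inner_self_eq_norm_sq]
  rw [h1, ← ss_key]
  set s := ss (l • z)
  have h2 : Bm (l • z) z = (1 - s * ‖l • z‖ ^ 2) • z := by
    unfold Bm
    rw [real_inner_smul_left, real_inner_self_eq_norm_sq, norm_smul, mul_pow, Real.norm_eq_abs, sq_abs]
    module
  rw [h2, norm_smul, mul_pow, Real.norm_eq_abs, sq_abs]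
  ring

theorem bar_pow {n : ℕ} (c A : ℝ) (x : Eu n) :
    bar (((n:ℝ) - 2) / 2) c A 0 0 x = c + A * ‖x‖ ^ ((2:ℝ) - n) := by
  simp only [bar, zero_mul, add_zero]
  rw [← Real.rpow_natCast ‖x‖ 2, ← Real.rpow_mul (norm_nonneg _)]
  have : ((2:ℕ):ℝ) * -(((n:ℝ) - 2) / 2) = 2 - n := by push_cast; ring
  rw [this]; ring

theorem comp {n : ℕ} (hn : 3 ≤ n) {R r0 L c A : ℝ} (hR : 0 < R) {u : Eu n → ℝ} (h : Sol R u)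
    (hr0 : R < r0) (hA : 0 < A)
    (b1 : ∀ x : Eu n, ‖x‖ = r0 → u x ≤ c + A * ‖x‖ ^ ((2:ℝ) - n))
    (b2 : ∀ x : Eu n, ‖x‖ = L → u x ≤ c + A * ‖x‖ ^ ((2:ℝ) - n))
    (x : Eu n) (hx1 : r0 ≤ ‖x‖) (hx2 : ‖x‖ ≤ L) : u x ≤ c + A * ‖x‖ ^ ((2:ℝ) - n) := by
  by_contra hcon
  push Not at hcon
  have hnR : (3:ℝ) ≤ n := by exact_mod_cast hn
  simp only [← bar_pow] at *
  set a := ((n:ℝ) - 2) / 2 with ha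
  have ha0 : 0 < a := by rw [ha]; linarith
  set Kc : Set (Eu n) := Metric.closedBall 0 L ∩ {w | r0 ≤ ‖w‖} with hKc
  have hKcc : IsCompact Kc :=
    (isCompact_closedBall 0 L).inter_right (isClosed_le continuous_const continuous_norm)
  have hc : ContinuousOn (fun w => u w - bar a c A 0 0 w) Kc := by
    rintro w ⟨hw1, hw2⟩
    have hw2 : r0 ≤ ‖w‖ := hw2
    apply ContinuousAt.continuousWithinAt
    refine (h.diff w (by linarith)).continuousAt.sub (bar_continuousAt _ _ _ _ _ _ ?_)
    rintro rfl; simp at hw2; linarith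
  have hxm : x ∈ Kc := ⟨by simpa using hx2, hx1⟩
  obtain ⟨z, ⟨hz1, hz2⟩, hmax⟩ := hKcc.exists_isMaxOn ⟨x, hxm⟩ hc
  have hz2 : r0 ≤ ‖z‖ := hz2
  have hz1 : ‖z‖ ≤ L := by simpa using hz1
  have hpos : 0 < u z - bar a c A 0 0 z := by
    have : u x - bar a c A 0 0 x ≤ u z - bar a c A 0 0 z := hmax hxm
    linarith
  have i1 : r0 < ‖z‖ := lt_of_le_of_ne hz2 fun he => by
    have := b1 z he.symm; linarith
  have i2 : ‖z‖ < L := lt_of_le_of_ne hz1 fun he => by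
    have := b2 z he; linarith
  have hloc : IsLocalMax (fun w => u w - bar a c A 0 0 w) z := by
    apply hmax.isLocalMax
    have hop : IsOpen (Metric.ball 0 L ∩ {w : Eu n | r0 < ‖w‖}) :=
      Metric.isOpen_ball.inter (isOpen_lt continuous_const continuous_norm)
    apply mem_of_superset (hop.mem_nhds (x := z) ⟨by simpa using i2, i1⟩)
    exact Set.inter_subset_inter Metric.ball_subset_closedBall
      (fun w (hw : r0 < ‖w‖) => (le_of_lt hw : r0 ≤ ‖w‖))
  have hz0 : z ≠ 0 := by rintro rfl; simp at hz2; linarith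
  obtain ⟨t1, t2⟩ := one_point (h.mj z (by linarith)) (bar_LJ a c A 0 0 z hz0) hloc
  simp only [zero_mul, add_zero, zero_smul, mul_zero, sub_zero] at t1 t2
  set Y1 := (‖z‖ ^ 2) ^ (-a - 1) with hY1
  set Y2 := (‖z‖ ^ 2) ^ (-a - 2) with hY2
  have hzn : 0 < ‖z‖ := norm_pos_iff.2 hz0
  have hs : 0 < ‖z‖ ^ 2 := by positivity
  have hY10 : 0 < Y1 := Real.rpow_pos_of_pos hs _
  have hY : Y1 = Y2 * ‖z‖ ^ 2 := by
    rw [hY1, hY2, ← Real.rpow_add_one hs.ne']; congr 1; ring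
  rw [t1, ← Finset.mul_sum, Finset.sum_add_distrib, ← Finset.mul_sum, ← Finset.mul_sum,
    Bm_sum_norm, Bm_sum_z] at t2
  set P := ‖(-(2 * a) * Y1 * A) • z‖ ^ 2 with hP
  have hP0 : 0 < P := by
    have e0 : (-(2 * a) * Y1 * A) ^ 2 = (2 * a * Y1 * A) ^ 2 := by ring
    rw [hP, norm_smul, Real.norm_eq_abs, mul_pow, sq_abs, e0]
    positivity
  set θ := (1 + P)⁻¹ * P with hθ
  have hθ0 : 0 < θ := by positivity
  have e : A * (-(2 * a) * Y1 * (n - θ) + 4 * a * (a + 1) * Y2 * (‖z‖ ^ 2 * (1 - θ)))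
      = -(A * (2 * a) * Y1 * θ * (n - 1)) := by
    rw [hY]
    have : (n:ℝ) = 2 * a + 2 := by rw [ha]; ring
    rw [this]; ring
  rw [e] at t2
  have : 0 < A * (2 * a) * Y1 * θ * (n - 1) := by
    have : (0:ℝ) < n - 1 := by linarith
    positivity
  linarith

theorem unitv {n : ℕ} (hn : 3 ≤ n) : ∃ e : Eu n, ‖e‖ = 1 := by
  obtain ⟨w, hw, _⟩ := exists_perp hn 0 0
  exact ⟨w, hw⟩

theorem pow_cancel {n : ℕ} {r : ℝ} (hr : 0 < r) : r ^ ((n:ℝ) - 2) * r ^ ((2:ℝ) - n) = 1 := by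
  rw [← Real.rpow_add hr]; simp

theorem bdd_up {n : ℕ} (hn : 3 ≤ n) {R r0 B : ℝ} (hR : 0 < R) {u : Eu n → ℝ} (h : Sol R u)
    (hr0 : R < r0) (ho : ∀ z z' : Eu n, r0 ≤ ‖z‖ → ‖z‖ = ‖z'‖ → u z - u z' ≤ B)
    (e : Eu n) (he : ‖e‖ = 1) : ∃ M : ℝ, ∀ L : ℝ, 2 * r0 ≤ L → u (L • e) ≤ M := by
  have hr00 : 0 < r0 := by linarith
  have hnR : (3:ℝ) ≤ n := by exact_mod_cast hn
  have hne : ∀ r : ℝ, 0 < r → ‖r • e‖ = r := fun r hr => by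
    rw [norm_smul, he, mul_one, Real.norm_eq_abs, abs_of_pos hr]
  set m0 := u (r0 • e) - B with hm0
  refine ⟨max (m0 + B) (2 * u ((2 * r0) • e) - m0 + B), fun L hL => ?_⟩
  have hL0 : 0 < L := by linarith
  set mL := u (L • e) - B with hmL
  by_cases hc : mL ≤ m0
  · exact le_max_of_le_left (by linarith)
  push Not at hc
  apply le_max_of_le_right
  have hd : 0 < mL - m0 := by linarith
  have hA : 0 < (mL - m0) * r0 ^ ((n:ℝ) - 2) := by positivity
  have := comp hn hR h.neg (r0 := r0) (L := L) (c := -mL) hr0 hA (by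
    intro x hx
    have h1 := ho (r0 • e) x (by rw [hne r0 hr00]) (by rw [hne r0 hr00, hx])
    rw [hx, mul_assoc, pow_cancel hr00]
    linarith) (by
    intro x hx
    have h1 := ho (L • e) x (by rw [hne L hL0]; linarith) (by rw [hne L hL0, hx])
    have h2 : 0 ≤ (mL - m0) * r0 ^ ((n:ℝ) - 2) * ‖x‖ ^ ((2:ℝ) - n) := by positivity
    linarith) ((2 * r0) • e) (by rw [hne _ (by linarith)]; linarith) (by rw [hne _ (by linarith)]; linarith)
  rw [hne _ (by linarith), Real.mul_rpow (by norm_num) hr00.le] at this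
  have e1 : (mL - m0) * r0 ^ ((n:ℝ) - 2) * (2 ^ ((2:ℝ) - n) * r0 ^ ((2:ℝ) - n)) = (mL - m0) * 2 ^ ((2:ℝ) - n) := by
    have := pow_cancel (n := n) hr00
    calc _ = (mL - m0) * 2 ^ ((2:ℝ) - n) * (r0 ^ ((n:ℝ) - 2) * r0 ^ ((2:ℝ) - n)) := by ring
      _ = _ := by rw [this, mul_one]
  have e2 : (2:ℝ) ^ ((2:ℝ) - n) ≤ 1/2 := by
    calc (2:ℝ) ^ ((2:ℝ) - n) ≤ 2 ^ (-1:ℝ) := Real.rpow_le_rpow_of_exponent_le (by norm_num) (by linarith)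
      _ = 1/2 := by rw [Real.rpow_neg_one]; norm_num
  have e3 : (mL - m0) * 2 ^ ((2:ℝ) - n) ≤ (mL - m0) * (1/2) := by gcongr
  rw [e1] at this
  linarith

theorem conv_up {n : ℕ} (hn : 3 ≤ n) {R r0 B a : ℝ} (hR : 0 < R) {u : Eu n → ℝ} (h : Sol R u)
    (hr0 : R + 2 < r0) (hB : 0 < B)
    (ho : ∀ z z' : Eu n, r0 ≤ ‖z‖ → ‖z‖ = ‖z'‖ → u z - u z' ≤ B * (‖z‖ ^ 2) ^ (-(1/4):ℝ))
    (e : Eu n) (he : ‖e‖ = 1) (L : ℕ → ℝ) (hL : Tendsto L atTop atTop)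
    (ha : Tendsto (fun k => u (L k • e)) atTop (𝓝 a)) :
    ∀ δ > 0, ∃ L0, ∀ x : Eu n, L0 ≤ ‖x‖ → u x ≤ a + δ := by
  intro δ hδ
  have hnR : (3:ℝ) ≤ n := by exact_mod_cast hn
  have t1 : Tendsto (fun r : ℝ => B * (r ^ 2) ^ (-(1/4):ℝ)) atTop (𝓝 0) := by
    have h1 : Tendsto (fun r : ℝ => (r ^ 2) ^ (-(1/4):ℝ)) atTop (𝓝 0) :=
      (tendsto_rpow_neg_atTop (by norm_num : (0:ℝ) < 1/4)).comp (tendsto_pow_atTop (by norm_num))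
    simpa using h1.const_mul B
  have t2 := t1.comp hL
  have ev : ∀ᶠ k in atTop, r0 ≤ L k ∧ u (L k • e) < a + δ/3 ∧ B * (L k ^ 2) ^ (-(1/4):ℝ) < δ/3 :=
    (hL.eventually_ge_atTop r0).and ((ha.eventually_lt_const (by linarith)).and
      (t2.eventually_lt_const (by linarith : (0:ℝ) < δ/3)))
  obtain ⟨k0, hk0⟩ := ev.exists_forall_of_atTop
  have sph : ∀ k ≥ k0, ∀ x : Eu n, ‖x‖ = L k → u x ≤ a + 2 * δ / 3 := by
    intro k hk x hx
    obtain ⟨h1, h2, h3⟩ := hk0 k hk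
    have hne : ‖L k • e‖ = L k := by
      rw [norm_smul, he, mul_one, Real.norm_eq_abs, abs_of_pos (by linarith)]
    have := ho x (L k • e) (by rw [hx]; exact h1) (by rw [hx, hne])
    rw [hx] at this
    linarith
  refine ⟨L k0, fun x hx => ?_⟩
  obtain ⟨k, hk, hk'⟩ := ((hL.eventually_ge_atTop ‖x‖).and (eventually_ge_atTop k0)).exists
  have h1 := (hk0 k0 le_rfl).1
  have pos : ∀ y : Eu n, 0 ≤ δ/3 * ‖y‖ ^ ((2:ℝ) - n) := fun y => by positivity
  have := comp hn hR h (r0 := L k0) (L := L k) (c := a + 2 * δ / 3) (A := δ/3) (by linarith) (by positivity)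
    (fun y hy => by have := sph k0 le_rfl y hy; have := pos y; linarith)
    (fun y hy => by have := sph k hk' y hy; have := pos y; linarith) x hx hk
  have h3 : ‖x‖ ^ ((2:ℝ) - n) ≤ 1 :=
    Real.rpow_le_one_of_one_le_of_nonpos (by linarith) (by linarith)
  have h4 : δ/3 * ‖x‖ ^ ((2:ℝ) - n) ≤ δ/3 * 1 := by gcongr
  linarith

theorem final_up {n : ℕ} (hn : 3 ≤ n) {R a : ℝ} (hR : 0 < R) {u : Eu n → ℝ} (h : Sol R u)
    (hc : ∀ δ > 0, ∃ L0, ∀ x : Eu n, L0 ≤ ‖x‖ → u x ≤ a + δ) :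
    ∃ C : ℝ, 0 < C ∧ ∀ x : Eu n, R + 1 ≤ ‖x‖ → u x - a ≤ C * ‖x‖ ^ ((2:ℝ) - n) := by
  have hcomp : IsCompact (Metric.sphere (0 : Eu n) (R + 1)) := isCompact_sphere _ _
  have hcont : ContinuousOn u (Metric.sphere (0 : Eu n) (R + 1)) := by
    intro x hx
    have : ‖x‖ = R + 1 := by simpa using hx
    exact (h.diff x (by linarith)).continuousAt.continuousWithinAt
  obtain ⟨D, hD⟩ := hcomp.bddAbove_image hcont
  have hD' : ∀ x : Eu n, ‖x‖ = R + 1 → u x ≤ D := fun x hx =>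
    hD ⟨x, by simpa using hx, rfl⟩
  have hR1 : 0 < R + 1 := by linarith
  have hA : 0 < (|D - a| + 1) * (R + 1) ^ ((n:ℝ) - 2) := by positivity
  refine ⟨(|D - a| + 1) * (R + 1) ^ ((n:ℝ) - 2), hA, fun x hx => ?_⟩
  apply le_of_forall_pos_le_add
  intro δ hδ
  obtain ⟨L0, hL0⟩ := hc δ hδ
  have := comp hn hR h (r0 := R + 1) (L := max L0 ‖x‖) (c := a + δ) (by linarith) hA (by
    intro y hy
    have h1 := hD' y hy
    have h2 := le_abs_self (D - a)
    rw [hy, mul_assoc, pow_cancel hR1]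
    linarith) (by
    intro y hy
    have h1 := hL0 y (by rw [hy]; exact le_max_left _ _)
    have : 0 ≤ (|D - a| + 1) * (R + 1) ^ ((n:ℝ) - 2) * ‖y‖ ^ ((2:ℝ) - n) := by positivity
    linarith) x hx (le_max_right _ _)
  linarith

theorem main {n : ℕ} (hn : 3 ≤ n) {R : ℝ} (hR : 0 < R) {u : Eu n → ℝ} (h : Sol R u)
    (hdecay : ∀ ε : ℝ, 0 < ε → ∃ R' : ℝ, ∀ x : Eu n, ‖x‖ ≥ R' → ‖gradient u x‖ ≤ ε) :
    ∃ a : ℝ, ∃ C : ℝ, 0 < C ∧ ∀ x : Eu n, ‖x‖ ≥ R + 1 → |u x - a| ≤ C * ‖x‖ ^ ((2 : ℝ) - n) := by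
  obtain ⟨r0, B, hr0, hB, ho⟩ := sphere_osc hn hR h hdecay
  obtain ⟨e, he⟩ := unitv hn
  have hoB : ∀ z z' : Eu n, r0 ≤ ‖z‖ → ‖z‖ = ‖z'‖ → u z - u z' ≤ B := by
    intro z z' h1 h2
    refine (ho z z' h1 h2).trans ?_
    have : (‖z‖ ^ 2) ^ (-(1/4):ℝ) ≤ 1 :=
      Real.rpow_le_one_of_one_le_of_nonpos (by nlinarith) (by norm_num)
    nlinarith
  have ho' : ∀ z z' : Eu n, r0 ≤ ‖z‖ → ‖z‖ = ‖z'‖ →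
      (- u z) - (- u z') ≤ B * (‖z‖ ^ 2) ^ (-(1/4):ℝ) := by
    intro z z' h1 h2
    have := ho z' z (by linarith) h2.symm
    rw [h2]; linarith
  obtain ⟨M1, hM1⟩ := bdd_up hn hR h (by linarith) hoB e he
  obtain ⟨M2, hM2⟩ := bdd_up hn hR h.neg (r0 := r0) (B := B) (by linarith)
    (fun z z' h1 h2 => by have := hoB z' z (by linarith) h2.symm; linarith) e he
  have hmem : ∀ k : ℕ, u ((2 * r0 + (k:ℝ)) • e) ∈ Set.Icc (-M2) M1 := by
    intro k
    have hk : 2 * r0 ≤ 2 * r0 + (k:ℝ) := by simp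
    have := hM2 _ hk
    exact ⟨by linarith, hM1 _ hk⟩
  obtain ⟨a, _, φ, hφ, ha⟩ := isCompact_Icc.tendsto_subseq hmem
  set Ls : ℕ → ℝ := fun k => 2 * r0 + (φ k : ℝ) with hLs
  have hLt : Tendsto Ls atTop atTop :=
    tendsto_atTop_add_const_left _ _ (tendsto_natCast_atTop_atTop.comp hφ.tendsto_atTop)
  have up := conv_up hn hR h hr0 hB ho e he Ls hLt ha
  have dn := conv_up hn hR h.neg hr0 hB ho' e he Ls hLt (a := -a) ha.neg
  obtain ⟨C1, hC1, H1⟩ := final_up hn hR h up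
  obtain ⟨C2, hC2, H2⟩ := final_up hn hR h.neg dn
  refine ⟨a, C1 + C2, by positivity, fun x hx => ?_⟩
  have g1 := H1 x hx
  have g2 := H2 x hx
  have : 0 ≤ ‖x‖ ^ ((2:ℝ) - n) := by positivity
  have k1 : 0 ≤ C1 * ‖x‖ ^ ((2:ℝ) - n) := by positivity
  have k2 : 0 ≤ C2 * ‖x‖ ^ ((2:ℝ) - n) := by positivity
  rw [abs_le]
  constructor <;> linarith

end MSE

/-- Asymptotics of exterior solutions of the minimal surface equation: if
`u` is smooth on `{‖x‖ > R}`, satisfies `div(∇u/√(1+|∇u|²)) = 0` there, and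
`‖∇u‖ → 0` at infinity, then there are `a ∈ ℝ` and `C > 0` with
`|u(x) − a| ≤ C ‖x‖^(2−n)` for `‖x‖ ≥ R + 1` (here `n ≥ 3`). -/
theorem stmt_10 (n : ℕ) (hn : 3 ≤ n) (R : ℝ) (hR : 0 < R)
    (u : EuclideanSpace ℝ (Fin n) → ℝ)
    (hu : ContDiffOn ℝ (⊤ : ℕ∞) u {x : EuclideanSpace ℝ (Fin n) | ‖x‖ > R})
    (hmse : ∀ x ∈ {x : EuclideanSpace ℝ (Fin n) | ‖x‖ > R},
      ∑ i : Fin n,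
        ⟪fderiv ℝ (fun y : EuclideanSpace ℝ (Fin n) =>
            (Real.sqrt (1 + ‖gradient u y‖ ^ 2))⁻¹ • gradient u y) x
          (EuclideanSpace.single i (1 : ℝ)),
          EuclideanSpace.single i (1 : ℝ)⟫_ℝ = 0)
    (hdecay : ∀ ε : ℝ, 0 < ε → ∃ R' : ℝ,
      ∀ x : EuclideanSpace ℝ (Fin n), ‖x‖ ≥ R' → ‖gradient u x‖ ≤ ε) :
    ∃ a : ℝ, ∃ C : ℝ, 0 < C ∧
      ∀ x : EuclideanSpace ℝ (Fin n), ‖x‖ ≥ R + 1 →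
        |u x - a| ≤ C * ‖x‖ ^ ((2 : ℝ) - n) := by
  have hop : IsOpen {x : EuclideanSpace ℝ (Fin n) | ‖x‖ > R} := isOpen_lt continuous_const continuous_norm
  have hc : ∀ x : MSE.Eu n, R < ‖x‖ → ContDiffAt ℝ 2 u x := fun x hx =>
    (hu.contDiffAt (hop.mem_nhds hx)).of_le (WithTop.coe_le_coe.2 (le_top : (2 : ℕ∞) ≤ ⊤))
  have h : MSE.Sol R u := ⟨fun x hx => (hc x hx).differentiableAt (by norm_num),
    fun x hx => MSE.MJ.of_div (hc x hx) (hmse x hx)⟩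
  exact MSE.main hn hR h hdecay
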